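/- Let T_ℓ : C_ℓ → C_ℓ be the action of the decorated SMART machine on cyclic tapes of length ℓ, and let G_ℓ ≤ Sym(C_ℓ) be the group of Turing machine instructions with its word norm ‖·‖. There exists a constant K > 0 such that for every ℓ ≥ 2 and every n ∈ ℕ, the permutation (T_ℓ)^n belongs to G_ℓ and ‖(T_ℓ)^n‖ ≤ K·ℓ⁴. -/

import Mathlib

/-- The word norm of `g` with respect to the generating set `F`:
the least `n` such that `g` is a product of `n` elements of `F ∪ F⁻¹`. -/
noncomputable def wordNorm {G : Type*} [Group G] (F : Set G) (g : G) : ℕ :=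
  sInf {n : ℕ | ∃ w : List G, w.length = n ∧ (∀ x ∈ w, x ∈ F ∨ x⁻¹ ∈ F) ∧ w.prod = g}
/-! ### Turing machine symbols and local step functions -/

/-- Tape/head symbols: a plain tape letter, or a head `(q, a)` on top of letter `a`. -/
abbrev TSym (Q Γ : Type) : Type := Γ ⊕ (Q × Γ)

/-- The tape letter carried by a cell (under the head if the cell carries the head). -/
def tapeLetter {Q Γ : Type} : TSym Q Γ → Γ
  | Sum.inl a => a
  | Sum.inr (_, a) => a

/-- A complete deterministic machine is given by a head-step function: at `(q, a)` it either
rewrites the head in place (`.inl (q', b)`, a matching transition), or moves in direction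
`δ ∈ {+1, -1}` into state `q'` (`.inr (δ, q')`, a move transition). -/
abbrev HeadStep (Q Γ : Type) : Type := Q → Γ → ((Q × Γ) ⊕ (ℤ × Q))

/-- If the symbol `s` carries a head about to move in direction `d`, the state in which the
head arrives; `none` otherwise. -/
def arrivesAs {Q Γ : Type} (δ : HeadStep Q Γ) (s : TSym Q Γ) (d : ℤ) : Option Q :=
  match s with
  | Sum.inl _ => none
  | Sum.inr (q, a) =>
    match δ q a with
    | Sum.inl _ => none
    | Sum.inr (d', q') => if d' = d then some q' else none

/-- The local rule of the moving-head dynamics: the new symbol of a cell, given the symbols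
`l, c, r` of its left neighbour, itself, and its right neighbour. -/
def localStep {Q Γ : Type} (δ : HeadStep Q Γ) (l c r : TSym Q Γ) : TSym Q Γ :=
  match c with
  | Sum.inr (q, a) =>
    (match δ q a with
     | Sum.inl qb => Sum.inr qb
     | Sum.inr _ => Sum.inl a)
  | Sum.inl a =>
    (match arrivesAs δ l 1 with
     | some q' => Sum.inr (q', a)
     | none =>
       match arrivesAs δ r (-1) with
       | some q' => Sum.inr (q', a)
       | none => Sum.inl a)

/-- The moving-head action of a complete deterministic machine on bi-infinite tapes. -/
def stepZ {Q Γ : Type} (δ : HeadStep Q Γ) (x : ℤ → TSym Q Γ) : ℤ → TSym Q Γ :=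
  fun i => localStep δ (x (i - 1)) (x i) (x (i + 1))

/-- The action of a complete deterministic machine on cyclic tapes of length `ℓ`. -/
def stepC {Q Γ : Type} (δ : HeadStep Q Γ) (ℓ : ℕ) (w : ZMod ℓ → TSym Q Γ) :
    ZMod ℓ → TSym Q Γ :=
  fun i => localStep δ (w (i - 1)) (w i) (w (i + 1))

/-- A configuration has at most one head. -/
def AtMostOneHeadZ {Q Γ : Type} (x : ℤ → TSym Q Γ) : Prop :=
  ∀ i j : ℤ, (x i).isRight = true → (x j).isRight = true → i = j

/-- A cyclic configuration has at most one head. -/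
def AtMostOneHeadC {Q Γ : Type} {ℓ : ℕ} (w : ZMod ℓ → TSym Q Γ) : Prop :=
  ∀ i j : ZMod ℓ, (w i).isRight = true → (w j).isRight = true → i = j

/-! ### The SMART machine -/

/-- The four arrows `▶, ◀, ▷, ◁` (filled right/left, hollow right/left). -/
inductive Arrow : Type
  | rf  -- ▶ (filled right)
  | lf  -- ◀ (filled left)
  | rh  -- ▷ (hollow right)
  | lh  -- ◁ (hollow left)
deriving DecidableEq

/-- The SMART state set `Q̊`: an arrow with a subscript in `{1,2}`; the subscript `b`
is represented by the `Fin 2` value `b - 1`. -/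
abbrev SQ : Type := Arrow × Fin 2

/-- The SMART tape alphabet `{0,1,2}`. -/
abbrev Letter : Type := Fin 3

/-- The head-step function of the SMART machine.  States `q₂` (second component `1`) are
move states; states `q₁` (second component `0`) are matching states. -/
def smartStep : HeadStep SQ Letter := fun q a =>
  if q.2 = 1 then
    match q.1 with
    | .rf => Sum.inr (1, (.rf, 0))   -- (▶₂, +1, ▶₁)
    | .lf => Sum.inr (-1, (.lf, 0))  -- (◀₂, −1, ◀₁)
    | .rh => Sum.inr (1, (.rh, 0))   -- (▷₂, +1, ▷₁)
    | .lh => Sum.inr (-1, (.lh, 0))  -- (◁₂, −1, ◁₁)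
  else
    match q.1 with
    | .rf => Sum.inl (if a = 0 then ((.lf, 1), 1) else if a = 1 then ((.lh, 1), 1) else ((.lh, 1), 2))
    | .lf => Sum.inl (if a = 0 then ((.rf, 1), 1) else if a = 1 then ((.rh, 1), 1) else ((.rh, 1), 2))
    | .rh => Sum.inl (if a = 0 then ((.rf, 1), 2) else if a = 1 then ((.rf, 1), 0) else ((.lh, 1), 0))
    | .lh => Sum.inl (if a = 0 then ((.lf, 1), 2) else if a = 1 then ((.lf, 1), 0) else ((.rh, 1), 0))

/-! ### The decorated SMART machine -/

/-- The state set of the decorated SMART machine: a SMART state together with a *duck*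
`d ∈ {d₀, d₁}` (as `Fin 2`, `0 ↦ d₀`) and a *ghost* `x ∈ {0,…,5}` (as `Fin 6`). -/
abbrev DQ : Type := SQ × Fin 2 × Fin 6

/-- The head-step function of the decorated SMART machine: it acts as SMART on the
`Q̊`-component and carries the duck and ghost unchanged. -/
def decStep : HeadStep DQ Letter := fun q a =>
  match smartStep q.1 a with
  | Sum.inl (q', b) => Sum.inl ((q', q.2), b)
  | Sum.inr (d, q') => Sum.inr (d, (q', q.2))

/-! ### The group `G_ℓ` of Turing machine instructions on cyclic tapes -/

/-- Cyclic configurations of length `ℓ` with at most one head. -/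
abbrev CConf (Q Γ : Type) (ℓ : ℕ) : Type :=
  {w : ZMod ℓ → TSym Q Γ // AtMostOneHeadC w}

/-- The pointwise action on symbols of a permutation `g` of head symbols. -/
def gateApply {Q Γ : Type} (g : Equiv.Perm (Q × Γ)) : TSym Q Γ → TSym Q Γ
  | Sum.inl a => Sum.inl a
  | Sum.inr h => Sum.inr (g h)

/-- `π` is the unary gate `π_g`: it applies `g` to the head symbol (if a head is present)
and fixes all other cells. -/
def IsUnaryGate {Q Γ : Type} {ℓ : ℕ} (g : Equiv.Perm (Q × Γ))
    (π : Equiv.Perm (CConf Q Γ ℓ)) : Prop :=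
  ∀ w : CConf Q Γ ℓ, ∀ i : ZMod ℓ, (π w).1 i = gateApply g (w.1 i)

/-- `π` is the state-dependent right move `ρ_q`: it moves a head in state `q` one position
to the right (mod `ℓ`), leaving its tape letter behind and picking up the next cell's
letter, and fixes configurations whose head is not in state `q`. -/
def IsMoveGate {Q Γ : Type} [DecidableEq Q] {ℓ : ℕ} (q : Q)
    (π : Equiv.Perm (CConf Q Γ ℓ)) : Prop :=
  ∀ w : CConf Q Γ ℓ,
    ((∀ i a, w.1 i ≠ Sum.inr (q, a)) → π w = w) ∧
    (∀ i a, w.1 i = Sum.inr (q, a) →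
      ∀ j : ZMod ℓ, (π w).1 j =
        if j = i + 1 then Sum.inr (q, tapeLetter (w.1 (i + 1)))
        else if j = i then Sum.inl a
        else w.1 j)

/-- The generating set of the group `G_ℓ` of Turing machine instructions: all unary gates
`π_g` and all state-dependent moves `ρ_q`. -/
def TMGens (Q Γ : Type) [DecidableEq Q] (ℓ : ℕ) : Set (Equiv.Perm (CConf Q Γ ℓ)) :=
  {π | (∃ g, IsUnaryGate g π) ∨ (∃ q, IsMoveGate q π)}

instance : Fintype Arrow where
  elems := {.rf, .lf, .rh, .lh}
  complete := by intro x; cases x <;> decide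

/-- Configurations on a cyclic tape that do carry a head: head position, state, tape. -/
@[ext]
structure HC (ℓ : ℕ) where
  /-- head position -/
  p : ZMod ℓ
  /-- state -/
  q : DQ
  /-- tape content -/
  t : ZMod ℓ → Letter

/-- Apply `g` to the state and the letter under the head. -/
def gateF {ℓ : ℕ} (g : DQ × Letter → DQ × Letter) (x : HC ℓ) : HC ℓ :=
  ⟨x.p, (g (x.q, x.t x.p)).1, Function.update x.t x.p (g (x.q, x.t x.p)).2⟩

/-- Move the head to the right if it is in state `q`. -/
def moveF {ℓ : ℕ} (q : DQ) (x : HC ℓ) : HC ℓ :=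
  if x.q = q then ⟨x.p + 1, x.q, x.t⟩ else x

/-- The permutation is a unary gate or a state-dependent move. -/
def IsGen {ℓ : ℕ} (π : Equiv.Perm (HC ℓ)) : Prop :=
  (∃ g : Equiv.Perm (DQ × Letter), ⇑π = gateF g) ∨ ∃ q, ⇑π = moveF q

/-- The function `f` is a permutation that is a product of at most `n` generators and
inverses of generators. -/
def FC {ℓ : ℕ} (f : HC ℓ → HC ℓ) (n : ℕ) : Prop :=
  ∃ w : List (Equiv.Perm (HC ℓ)), w.length ≤ n ∧ (∀ x ∈ w, IsGen x ∨ IsGen x⁻¹) ∧ ⇑w.prod = f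

namespace FC

variable {ℓ : ℕ} {f g : HC ℓ → HC ℓ} {m n : ℕ}

theorem mono (h : FC f m) (hmn : m ≤ n) : FC f n := by
  obtain ⟨w, h1, h2, h3⟩ := h
  exact ⟨w, h1.trans hmn, h2, h3⟩

theorem bijective (h : FC f m) : Function.Bijective f := by
  obtain ⟨w, _, _, rfl⟩ := h
  exact w.prod.bijective

theorem id : FC (ℓ := ℓ) id 0 := ⟨[], by simp, by simp, by simp⟩

theorem comp (hf : FC f m) (hg : FC g n) : FC (f ∘ g) (m + n) := by
  obtain ⟨w, h1, h2, rfl⟩ := hf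
  obtain ⟨v, k1, k2, rfl⟩ := hg
  refine ⟨w ++ v, by simp; omega, ?_, by simp⟩
  intro x hx
  rcases List.mem_append.1 hx with h | h
  exacts [h2 x h, k2 x h]

theorem of_eq (hf : FC f m) (h : ∀ x, g x = f x) : FC g m := by
  rwa [show g = f from funext h]

theorem inv (hf : FC f m) (h : ∀ x, g (f x) = x) : FC g m := by
  obtain ⟨w, h1, h2, rfl⟩ := hf
  refine ⟨(w.map (·⁻¹)).reverse, by simpa using h1, ?_, ?_⟩
  · intro x hx
    simp only [List.mem_reverse, List.mem_map] at hx
    obtain ⟨y, hy, rfl⟩ := hx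
    rw [inv_inv]
    exact (h2 y hy).symm
  · rw [← List.prod_inv_reverse]
    funext x
    obtain ⟨y, rfl⟩ := w.prod.surjective x
    simp [h]

theorem iterate (hf : FC f m) (k : ℕ) : FC f^[k] (k * m) := by
  induction k with
  | zero => simpa using FC.id
  | succ k ih =>
    rw [Function.iterate_succ, Nat.succ_mul]
    exact ih.comp hf

theorem of_perm (π : Equiv.Perm (HC ℓ)) (h : IsGen π) : FC π 1 :=
  ⟨[π], by simp, by simp [h], by simp⟩

end FC

theorem gateF_gateF {ℓ : ℕ} (g h : DQ × Letter → DQ × Letter) (x : HC ℓ) :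
    gateF g (gateF h x) = gateF (g ∘ h) x := by
  simp [gateF]

theorem FC.gate {ℓ : ℕ} (g : Equiv.Perm (DQ × Letter)) : FC (ℓ := ℓ) (gateF g) 1 := by
  refine FC.of_perm ⟨gateF g, gateF g.symm, fun x => ?_, fun x => ?_⟩ (Or.inl ⟨g, rfl⟩) <;>
  · rw [gateF_gateF]
    simp [gateF]

theorem FC.gate_fun {ℓ : ℕ} (g : DQ × Letter → DQ × Letter) (hg : Function.Bijective g) :
    FC (ℓ := ℓ) (gateF g) 1 := FC.gate (Equiv.ofBijective g hg)

/-- Move the head by a state-dependent amount. -/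
def shiftF {ℓ : ℕ} (e : DQ → ℤ) (x : HC ℓ) : HC ℓ := ⟨x.p + (e x.q : ℤ), x.q, x.t⟩

theorem FC.move {ℓ : ℕ} (q : DQ) : FC (ℓ := ℓ) (moveF q) 1 := by
  refine FC.of_perm ⟨moveF q, fun x => if x.q = q then ⟨x.p - 1, x.q, x.t⟩ else x,
    fun x => ?_, fun x => ?_⟩ (Or.inr ⟨q, rfl⟩) <;>
  · by_cases h : x.q = q
    · simp only [moveF, h, if_true]
      ext <;> simp [h]
    · simp [moveF, h]

theorem shiftF_shiftF {ℓ : ℕ} (e e' : DQ → ℤ) (x : HC ℓ) :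
    shiftF e (shiftF e' x) = shiftF (e + e') x := by
  simp [shiftF]; ring

theorem shiftF_inv {ℓ : ℕ} (e : DQ → ℤ) (x : HC ℓ) : shiftF (-e) (shiftF e x) = x := by
  simp [shiftF]

theorem FC.shift_single {ℓ : ℕ} (q : DQ) (c : ℤ) :
    FC (ℓ := ℓ) (shiftF (Pi.single q c)) c.natAbs := by
  have pos : ∀ k : ℕ, FC (ℓ := ℓ) (shiftF (Pi.single q (k : ℤ))) k := by
    intro k
    have := (FC.move (ℓ := ℓ) q).iterate k
    rw [mul_one] at this
    refine this.of_eq fun x => ?_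
    clear this
    induction k generalizing x with
    | zero => simp [shiftF]
    | succ k ih =>
      rw [Function.iterate_succ_apply, ← ih]
      by_cases h : x.q = q <;> simp [shiftF, moveF, h]
      ring
  obtain ⟨k, rfl | rfl⟩ := c.eq_nat_or_neg
  · simpa using pos k
  · rw [Pi.single_neg, Int.natAbs_neg, Int.natAbs_natCast]
    exact (pos k).inv fun x => shiftF_inv _ x

theorem FC.shift {ℓ : ℕ} (e : DQ → ℤ) (M : ℕ) (h : ∀ q, (e q).natAbs ≤ M) :
    FC (ℓ := ℓ) (shiftF e) (96 * M) := by
  have key : ∀ s : Finset DQ, FC (ℓ := ℓ) (shiftF (∑ q ∈ s, Pi.single q (e q))) (s.card * M) := by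
    intro s
    induction s using Finset.induction_on with
    | empty => exact FC.id.of_eq (fun x => by simp [shiftF]) |>.mono (Nat.zero_le _)
    | insert q s hq ih =>
      rw [Finset.sum_insert hq, Finset.card_insert_of_notMem hq, add_comm s.card, add_mul, one_mul]
      refine (((FC.shift_single q (e q)).mono (h q)).comp ih).of_eq fun x => ?_
      rw [Function.comp_apply, shiftF_shiftF]
  have := key Finset.univ
  rwa [Finset.univ_sum_single, show (Finset.univ : Finset DQ).card = 96 from by decide +kernel] at this

open Classical in
/-- Apply `α` to the ghost if the condition `P` on head position and tape holds. -/
noncomputable def ctlF {ℓ : ℕ} (P : ZMod ℓ → (ZMod ℓ → Letter) → Prop) (α : Equiv.Perm (Fin 6))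
    (x : HC ℓ) : HC ℓ :=
  if P x.p x.t then ⟨x.p, (x.q.1, x.q.2.1, α x.q.2.2), x.t⟩ else x

/-- Every three-cycle of the ghost controlled by `P` costs at most `n`. -/
def CP {ℓ : ℕ} (P : ZMod ℓ → (ZMod ℓ → Letter) → Prop) (n : ℕ) : Prop :=
  ∀ α : Equiv.Perm (Fin 6), α.IsThreeCycle → FC (ctlF P α) n

theorem IsThreeCycle.exists_commutator (α : Equiv.Perm (Fin 6)) (hα : α.IsThreeCycle) :
    ∃ β γ : Equiv.Perm (Fin 6), β.IsThreeCycle ∧ γ.IsThreeCycle ∧ α = β * γ * β⁻¹ * γ⁻¹ := by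
  have h3 : ∀ a b c : Fin 6, a ≠ b → a ≠ c → b ≠ c →
      (Equiv.swap a b * Equiv.swap a c).IsThreeCycle := fun a b c h1 h2 h3 =>
    Equiv.Perm.isThreeCycle_swap_mul_swap_same h1 h2 h3
  have hβ := h3 0 1 2 (by decide) (by decide) (by decide)
  have hγ := h3 0 3 4 (by decide) (by decide) (by decide)
  obtain ⟨x, y, z, h1, h2, h4, hxyz⟩ : ∃ x y z : Fin 6, x ≠ y ∧ x ≠ z ∧ y ≠ z ∧
      (Equiv.swap 0 1 * Equiv.swap 0 2) * (Equiv.swap 0 3 * Equiv.swap 0 4) *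
      (Equiv.swap (0 : Fin 6) 1 * Equiv.swap 0 2)⁻¹ * (Equiv.swap 0 3 * Equiv.swap 0 4)⁻¹ =
      Equiv.swap x y * Equiv.swap x z := by decide +kernel
  have hc := h3 x y z h1 h2 h4
  rw [← hxyz] at hc
  have : IsConj ((Equiv.swap 0 1 * Equiv.swap 0 2) * (Equiv.swap 0 3 * Equiv.swap 0 4) *
      (Equiv.swap (0 : Fin 6) 1 * Equiv.swap 0 2)⁻¹ * (Equiv.swap 0 3 * Equiv.swap 0 4)⁻¹) α :=
    Equiv.Perm.isConj_iff_cycleType_eq.2 (hc.trans hα.symm)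
  obtain ⟨c, hc⟩ := isConj_iff.1 this
  have conj : ∀ σ : Equiv.Perm (Fin 6), σ.IsThreeCycle → (c * σ * c⁻¹).IsThreeCycle := by
    intro σ hσ
    rw [Equiv.Perm.IsThreeCycle, Equiv.Perm.cycleType_conj]
    exact hσ
  refine ⟨_, _, conj _ hβ, conj _ hγ, ?_⟩
  rw [← hc]
  group

namespace CP

variable {ℓ : ℕ} {P Q : ZMod ℓ → (ZMod ℓ → Letter) → Prop} {a b : ℕ}

theorem mono (h : CP P a) (hab : a ≤ b) : CP P b := fun α hα => (h α hα).mono hab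

theorem congr (h : CP P a) (hPQ : ∀ p t, Q p t ↔ P p t) : CP Q a := by
  rwa [show Q = P from funext fun p => funext fun t => propext (hPQ p t)]

theorem and (hP : CP P a) (hQ : CP Q b) : CP (fun p t => P p t ∧ Q p t) (2 * a + 2 * b) := by
  intro α hα
  obtain ⟨β, γ, hβ, hγ, rfl⟩ := IsThreeCycle.exists_commutator α hα
  refine ((((hP β hβ).comp (hQ γ hγ)).comp (hP β⁻¹ hβ.inv)).comp (hQ γ⁻¹ hγ.inv)).mono
    (by omega : a + b + a + b ≤ _) |>.of_eq fun x => ?_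
  by_cases h1 : P x.p x.t <;> by_cases h2 : Q x.p x.t <;> simp [ctlF, h1, h2]

theorem or (hP : CP P a) (hQ : CP Q b) (hd : ∀ p t, P p t → ¬ Q p t) :
    CP (fun p t => P p t ∨ Q p t) (a + b) := by
  intro α hα
  refine ((hP α hα).comp (hQ α hα)).of_eq fun x => ?_
  have := hd x.p x.t
  by_cases h1 : P x.p x.t <;> by_cases h2 : Q x.p x.t <;> simp_all [ctlF]

theorem shift (hP : CP P a) (c : ℤ) (M : ℕ) (hc : c.natAbs ≤ M) :
    CP (fun p t => P (p + (c : ZMod ℓ)) t) (a + 192 * M) := by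
  intro α hα
  refine (((FC.shift (fun _ => -c) M (fun _ => by simpa using hc)).comp (hP α hα)).comp
    (FC.shift (fun _ => c) M (fun _ => hc))).mono (by omega) |>.of_eq fun x => ?_
  by_cases h1 : P (x.p + c) x.t <;> simp [ctlF, shiftF, h1]

theorem cell (A : Set Letter) : CP (ℓ := ℓ) (fun p t => t p ∈ A) 1 := by
  classical
  intro α _
  let g : Equiv.Perm (DQ × Letter) :=
    ⟨fun u => if u.2 ∈ A then ((u.1.1, u.1.2.1, α u.1.2.2), u.2) else u,
     fun u => if u.2 ∈ A then ((u.1.1, u.1.2.1, α.symm u.1.2.2), u.2) else u,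
     fun u => by by_cases h : u.2 ∈ A <;> simp [h],
     fun u => by by_cases h : u.2 ∈ A <;> simp [h]⟩
  refine (FC.gate g).of_eq fun x => ?_
  by_cases h : x.t x.p ∈ A <;> simp [ctlF, gateF, h, g]

theorem false : CP (ℓ := ℓ) (fun _ _ => False) 0 :=
  fun _ _ => FC.id.of_eq fun x => by simp [ctlF]

end CP

/-- All cells of the window starting at `p` lie in the first components of `L`. -/
def allW {ℓ : ℕ} (δ : ℤ) : List (Set Letter × Set Letter) → ZMod ℓ → (ZMod ℓ → Letter) → Prop
  | [], _, _ => True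
  | e :: L, p, t => t p ∈ e.1 ∧ allW δ L (p + (δ : ZMod ℓ)) t

/-- Scanning the window starting at `p`, a cell in the second component of its entry is met
while all cells before it lie in the first components. -/
def scanW {ℓ : ℕ} (δ : ℤ) : List (Set Letter × Set Letter) → ZMod ℓ → (ZMod ℓ → Letter) → Prop
  | [], _, _ => False
  | e :: L, p, t => t p ∈ e.2 ∨ (t p ∈ e.1 ∧ scanW δ L (p + (δ : ZMod ℓ)) t)

theorem allW_append {ℓ : ℕ} (δ : ℤ) (L L' : List (Set Letter × Set Letter)) (p : ZMod ℓ)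
    (t : ZMod ℓ → Letter) :
    allW δ (L ++ L') p t ↔ allW δ L p t ∧ allW δ L' (p + ((L.length * δ : ℤ) : ZMod ℓ)) t := by
  induction L generalizing p with
  | nil => simp [allW]
  | cons e L ih =>
    simp only [List.cons_append, allW, ih, and_assoc, List.length_cons]
    rw [show p + (δ : ZMod ℓ) + ((L.length * δ : ℤ) : ZMod ℓ) = p + (((L.length + 1 : ℕ) * δ : ℤ) : ZMod ℓ) by
      push_cast; ring]

theorem scanW_append {ℓ : ℕ} (δ : ℤ) (L L' : List (Set Letter × Set Letter)) (p : ZMod ℓ)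
    (t : ZMod ℓ → Letter) :
    scanW δ (L ++ L') p t ↔
      scanW δ L p t ∨ (allW δ L p t ∧ scanW δ L' (p + ((L.length * δ : ℤ) : ZMod ℓ)) t) := by
  induction L generalizing p with
  | nil => simp [allW, scanW]
  | cons e L ih =>
    simp only [List.cons_append, allW, scanW, ih, List.length_cons]
    rw [show p + (δ : ZMod ℓ) + ((L.length * δ : ℤ) : ZMod ℓ) = p + (((L.length + 1 : ℕ) * δ : ℤ) : ZMod ℓ) by
      push_cast; ring]
    tauto

theorem not_allW_of_scanW {ℓ : ℕ} (δ : ℤ) (L : List (Set Letter × Set Letter))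
    (hL : ∀ e ∈ L, Disjoint e.1 e.2) (p : ZMod ℓ) (t : ZMod ℓ → Letter) (h : scanW δ L p t) :
    ¬ allW δ L p t := by
  induction L generalizing p with
  | nil => exact absurd h (by simp [scanW])
  | cons e L ih =>
    intro ha
    rcases h with h | h
    · exact Set.disjoint_left.1 (hL e (by simp)) ha.1 h
    · exact ih (fun e he => hL e (by simp [he])) _ h.2 ha.2

theorem natAbs_length_mul_le {α : Type*} (L : List α) (δ : ℤ) (hδ : δ.natAbs ≤ 1) (m : ℕ)
    (hL : L.length ≤ m) : ((L.length : ℤ) * δ).natAbs ≤ m := by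
  rw [Int.natAbs_mul, Int.natAbs_natCast]
  nlinarith

theorem CP.allW {ℓ : ℕ} (δ : ℤ) (hδ : δ.natAbs ≤ 1) (n : ℕ) :
    ∀ L : List (Set Letter × Set Letter), L.length ≤ 2 ^ n →
      ∃ a, CP (ℓ := ℓ) (allW δ L) a ∧ a + 192 * 2 ^ n ≤ 193 * 4 ^ n := by
  induction n with
  | zero =>
    intro L hL
    refine ⟨1, ?_, by simp⟩
    rcases L with _ | ⟨e, _ | ⟨e', L⟩⟩
    · exact (CP.cell Set.univ).congr (by simp [_root_.allW])
    · exact (CP.cell e.1).congr (by simp [_root_.allW])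
    · simp at hL
  | succ n ih =>
    intro L hL
    have h1 : (L.take (2 ^ n)).length ≤ 2 ^ n := by simp
    obtain ⟨a, ha, ha'⟩ := ih _ h1
    obtain ⟨b, hb, hb'⟩ := ih (L.drop (2 ^ n)) (by rw [pow_succ] at hL; simp; omega)
    refine ⟨_, (ha.and (hb.shift _ _ (natAbs_length_mul_le _ δ hδ _ h1))).congr fun p t => ?_, ?_⟩
    · conv_lhs => rw [← List.take_append_drop (2 ^ n) L]
      exact allW_append ..
    · rw [pow_succ, pow_succ]
      omega

theorem CP.scanW {ℓ : ℕ} (δ : ℤ) (hδ : δ.natAbs ≤ 1) (n : ℕ) :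
    ∀ L : List (Set Letter × Set Letter), (∀ e ∈ L, Disjoint e.1 e.2) → L.length ≤ 2 ^ n →
      CP (ℓ := ℓ) (scanW δ L) (770 * 4 ^ n) := by
  induction n with
  | zero =>
    intro L _ hL
    rcases L with _ | ⟨e, _ | ⟨e', L⟩⟩
    · exact (CP.false.congr (by simp [_root_.scanW])).mono (by simp)
    · exact ((CP.cell e.2).congr (by simp [_root_.scanW])).mono (by simp)
    · simp at hL
  | succ n ih =>
    intro L hd hL
    have h1 : (L.take (2 ^ n)).length ≤ 2 ^ n := by simp
    obtain ⟨a, ha, ha'⟩ := CP.allW (ℓ := ℓ) δ hδ n _ h1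
    have hs := ih _ (fun e he => hd e (List.mem_of_mem_take he)) h1
    have hb := ih (L.drop (2 ^ n)) (fun e he => hd e (List.mem_of_mem_drop he))
      (by rw [pow_succ] at hL; simp; omega)
    refine ((hs.or (ha.and (hb.shift _ _ (natAbs_length_mul_le _ δ hδ _ h1)))
      fun p t h h' => ?_).congr fun p t => ?_).mono ?_
    · exact not_allW_of_scanW δ _ (fun e he => hd e (List.mem_of_mem_take he)) p t h h'.1
    · conv_lhs => rw [← List.take_append_drop (2 ^ n) L]
      exact scanW_append ..
    · have : 2 ^ n ≤ 4 ^ n := Nat.pow_le_pow_left (by norm_num) n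
      rw [pow_succ 4]
      omega

theorem CP.scanW_le {ℓ : ℕ} (hℓ : 1 ≤ ℓ) (δ : ℤ) (hδ : δ.natAbs ≤ 1)
    (L : List (Set Letter × Set Letter)) (hd : ∀ e ∈ L, Disjoint e.1 e.2) (hL : L.length ≤ ℓ) :
    CP (ℓ := ℓ) (_root_.scanW δ L) (3080 * ℓ ^ 2) := by
  have h1 : ℓ ≤ 2 ^ Nat.clog 2 ℓ := Nat.le_pow_clog (by norm_num) ℓ
  have h2 : 2 ^ Nat.clog 2 ℓ ≤ 2 * ℓ := by
    rcases hℓ.eq_or_lt with rfl | h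
    · simp
    · have := Nat.pow_pred_clog_lt_self (b := 2) (by norm_num) h
      have h3 : 0 < Nat.clog 2 ℓ := Nat.clog_pos (by norm_num) h
      obtain ⟨k, hk⟩ := Nat.exists_eq_succ_of_ne_zero h3.ne'
      rw [hk] at this ⊢
      rw [Nat.pred_succ] at this
      rw [pow_succ]
      omega
  refine (CP.scanW δ hδ (Nat.clog 2 ℓ) L hd (hL.trans h1)).mono ?_
  rw [show (4 : ℕ) = 2 * 2 from rfl, mul_pow]
  nlinarith

open Classical in
/-- Apply the gate `g` if the condition `P` on head position and tape holds. -/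
noncomputable def cgF {ℓ : ℕ} (P : ZMod ℓ → (ZMod ℓ → Letter) → Prop)
    (g : DQ × Letter → DQ × Letter) (x : HC ℓ) : HC ℓ :=
  if P x.p x.t then gateF g x else x

theorem scanW_congr {ℓ : ℕ} (δ : ℤ) (L : List (Set Letter × Set Letter)) (p : ZMod ℓ)
    (t t' : ZMod ℓ → Letter) (h : ∀ i < L.length, t (p + δ * i) = t' (p + δ * i)) :
    scanW δ L p t ↔ scanW δ L p t' := by
  induction L generalizing p with
  | nil => simp [scanW]
  | cons e L ih =>
    have h0 := h 0 (by simp)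
    simp only [Nat.cast_zero, mul_zero, add_zero] at h0
    rw [scanW, scanW, h0, ih]
    intro i hi
    have := h (i + 1) (by simpa using hi)
    push_cast at this
    rwa [mul_add, mul_one, add_comm _ (δ : ZMod ℓ), ← add_assoc] at this

theorem ZMod.cast_mul_ne_zero {ℓ : ℕ} (δ : ℤ) (hδ : δ.natAbs = 1) (i : ℕ) (h1 : 1 ≤ i)
    (h2 : i < ℓ) : (δ * i : ZMod ℓ) ≠ 0 := by
  have h3 : (i : ZMod ℓ) ≠ 0 := by
    rw [Ne, ZMod.natCast_eq_zero_iff]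
    exact Nat.not_dvd_of_pos_of_lt h1 h2
  rcases Int.natAbs_eq δ with h | h <;> rw [h, hδ] <;> simpa using h3

theorem scanW_update {ℓ : ℕ} (δ : ℤ) (hδ : δ.natAbs = 1) (L : List (Set Letter × Set Letter))
    (hL : L.length < ℓ) (p : ZMod ℓ) (t : ZMod ℓ → Letter) (b : Letter) :
    scanW δ L (p + (δ : ZMod ℓ)) (Function.update t p b) ↔ scanW δ L (p + (δ : ZMod ℓ)) t := by
  apply scanW_congr
  intro i hi
  rw [Function.update_of_ne]
  have := ZMod.cast_mul_ne_zero (ℓ := ℓ) δ hδ (i + 1) (by omega) (by omega)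
  contrapose! this
  push_cast
  linear_combination this

/-- Windows next to the head that do not contain the head position. -/
structure IsWindow (ℓ : ℕ) (δ : ℤ) (L : List (Set Letter × Set Letter)) : Prop where
  two_le : 2 ≤ ℓ
  dir : δ.natAbs = 1
  disj : ∀ e ∈ L, Disjoint e.1 e.2
  length_lt : L.length < ℓ

theorem IsWindow.scanW_gateF {ℓ : ℕ} {δ : ℤ} {L : List (Set Letter × Set Letter)}
    (h : IsWindow ℓ δ L) (g : DQ × Letter → DQ × Letter) (x : HC ℓ) :
    scanW δ L ((gateF g x).p + (δ : ZMod ℓ)) (gateF g x).t ↔ scanW δ L (x.p + (δ : ZMod ℓ)) x.t :=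
  scanW_update δ h.dir L h.length_lt ..

/-- The gates whose control by windows costs `O(ℓ²)`. -/
def controllable : Subgroup (Equiv.Perm (DQ × Letter)) where
  carrier := {g | ∃ C : ℕ, ∀ ℓ δ L, IsWindow ℓ δ L →
    FC (cgF (ℓ := ℓ) (fun p t => scanW δ L (p + (δ : ZMod ℓ)) t) g) (C * ℓ ^ 2)}
  one_mem' := ⟨0, fun ℓ δ L _ => (FC.id.of_eq fun x => by simp [cgF, gateF]).mono (by simp)⟩
  mul_mem' := by
    rintro g h ⟨C, hg⟩ ⟨C', hh⟩
    refine ⟨C + C', fun ℓ δ L hw => ?_⟩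
    rw [add_mul]
    refine ((hg ℓ δ L hw).comp (hh ℓ δ L hw)).of_eq fun x => ?_
    by_cases hx : scanW δ L (x.p + (δ : ZMod ℓ)) x.t
    · simp [cgF, hx, hw.scanW_gateF, gateF_gateF]
    · simp [cgF, hx]
  inv_mem' := by
    rintro g ⟨C, hg⟩
    refine ⟨C, fun ℓ δ L hw => (hg ℓ δ L hw).inv fun x => ?_⟩
    by_cases hx : scanW δ L (x.p + (δ : ZMod ℓ)) x.t
    · simp [cgF, hx, hw.scanW_gateF, gateF_gateF]
      simp [gateF]
    · simp [cgF, hx]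

instance : controllable.Normal where
  conj_mem := by
    rintro g ⟨C, hg⟩ c
    refine ⟨C + 2, fun ℓ δ L hw => ?_⟩
    refine (((FC.gate c).comp (hg ℓ δ L hw)).comp (FC.gate c⁻¹)).mono ?_ |>.of_eq fun x => ?_
    · have := hw.two_le
      nlinarith
    by_cases hx : scanW δ L (x.p + (δ : ZMod ℓ)) x.t
    · simp [cgF, hx, hw.scanW_gateF, gateF_gateF]
      rfl
    · simp [cgF, hx, hw.scanW_gateF, gateF_gateF]
      simp [gateF]

/-- The action of a permutation of the ghost. -/
def ghostPerm (α : Equiv.Perm (Fin 6)) : Equiv.Perm (DQ × Letter) :=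
  ((Equiv.refl SQ).prodCongr ((Equiv.refl (Fin 2)).prodCongr α)).prodCongr (Equiv.refl Letter)

theorem ghostPerm_mem (α : Equiv.Perm (Fin 6)) (hα : α.IsThreeCycle) :
    ghostPerm α ∈ controllable := by
  refine ⟨3080 + 192, fun ℓ δ L hw => ?_⟩
  have h2 := hw.two_le
  refine (((CP.scanW_le (by omega) δ hw.dir.le L hw.disj hw.length_lt.le).shift δ 1 hw.dir.le)
    α hα).mono (by nlinarith) |>.of_eq fun x => ?_
  by_cases hx : scanW δ L (x.p + (δ : ZMod ℓ)) x.t <;> simp [cgF, ctlF, hx, gateF, ghostPerm, Prod.map]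

theorem alternatingGroup_le_controllable : alternatingGroup (DQ × Letter) ≤ controllable := by
  obtain ⟨τ, hτ, hmem⟩ : ∃ τ : Equiv.Perm (DQ × Letter), τ.IsThreeCycle ∧ τ ∈ controllable := by
    let α : Equiv.Perm (Fin 6) := Equiv.swap 0 1 * Equiv.swap 0 2
    have hα : α.IsThreeCycle :=
      Equiv.Perm.isThreeCycle_swap_mul_swap_same (by decide) (by decide) (by decide)
    have hm := ghostPerm_mem α hα
    let e : Fin 6 → DQ × Letter := fun i => (((.rf, 0), 0, i), 0)
    have he : Function.Injective e := fun i j h => by simpa [e] using h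
    have hge : ∀ i, ghostPerm α (e i) = e (α i) := fun i => rfl
    refine ⟨Equiv.swap (e 2) (e 1) * Equiv.swap (e 2) (e 0),
      Equiv.Perm.isThreeCycle_swap_mul_swap_same (he.ne (by decide)) (he.ne (by decide))
        (he.ne (by decide)), ?_⟩
    have h1 : ghostPerm α * Equiv.swap (e 2) (e 0) * (ghostPerm α)⁻¹ =
        Equiv.swap (e 2) (e 1) := by
      rw [← Equiv.swap_apply_apply, hge, hge, show α 2 = 1 by decide, show α 0 = 2 by decide,
        Equiv.swap_comm]
    rw [← h1, mul_assoc, mul_assoc]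
    refine mul_mem hm ?_
    rw [← mul_assoc]
    have h2 : Equiv.swap (e 2) (e 0) = (Equiv.swap (e 2) (e 0))⁻¹ := (Equiv.swap_inv _ _).symm
    nth_rewrite 2 [h2]
    exact Subgroup.Normal.conj_mem inferInstance _ (inv_mem hm) _
  rw [← Equiv.Perm.closure_three_cycles_eq_alternating, Subgroup.closure_le]
  intro σ hσ
  obtain ⟨c, hc⟩ := isConj_iff.1 (Equiv.Perm.isConj_iff_cycleType_eq.2 (hτ.trans hσ.symm))
  rw [← hc]
  exact Subgroup.Normal.conj_mem inferInstance τ hmem c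

/-- A map on arrow, duck and letter, acting on head symbols with subscript and ghost passive. -/
def lg (h : Arrow × Fin 2 × Letter → Arrow × Fin 2 × Letter) (u : DQ × Letter) : DQ × Letter :=
  (((( h (u.1.1.1, u.1.2.1, u.2)).1, u.1.1.2), ((h (u.1.1.1, u.1.2.1, u.2)).2.1, u.1.2.2)),
    (h (u.1.1.1, u.1.2.1, u.2)).2.2)

/-- Separates subscript and ghost from arrow, duck and letter. -/
def logicEquiv : DQ × Letter ≃ (Fin 2 × Fin 6) × (Arrow × Fin 2 × Letter) where
  toFun u := ((u.1.1.2, u.1.2.2), (u.1.1.1, u.1.2.1, u.2))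
  invFun v := (((v.2.1, v.1.1), (v.2.2.1, v.1.2)), v.2.2.2)
  left_inv _ := rfl
  right_inv _ := rfl

theorem exists_lg_perm (h : Equiv.Perm (Arrow × Fin 2 × Letter)) :
    ∃ g ∈ alternatingGroup (DQ × Letter), ⇑g = lg h := by
  refine ⟨logicEquiv.symm.permCongr (Equiv.prodCongrRight fun _ => h), ?_, ?_⟩
  · rw [Equiv.Perm.mem_alternatingGroup, Equiv.Perm.sign_permCongr,
      Equiv.Perm.sign_prodCongrRight]
    simp only [Finset.prod_const]
    rw [show (Finset.univ : Finset (Fin 2 × Fin 6)).card = 2 * 6 from rfl, pow_mul]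
    simp [Int.units_sq]
  · funext u
    rfl

theorem FC.lg {ℓ : ℕ} {h : Arrow × Fin 2 × Letter → Arrow × Fin 2 × Letter}
    (hh : Function.Bijective h) : FC (ℓ := ℓ) (gateF (lg h)) 1 := by
  obtain ⟨g, _, hg⟩ := exists_lg_perm (Equiv.ofBijective h hh)
  exact (FC.gate g).of_eq fun x => by rw [hg]; rfl

theorem exists_controlled_lg : ∃ C : ℕ, ∀ h : Arrow × Fin 2 × Letter → Arrow × Fin 2 × Letter,
    Function.Bijective h → ∀ ℓ δ L, IsWindow ℓ δ L →
      FC (cgF (ℓ := ℓ) (fun p t => scanW δ L (p + (δ : ZMod ℓ)) t) (lg h)) (C * ℓ ^ 2) := by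
  have key : ∀ h : Equiv.Perm (Arrow × Fin 2 × Letter), ∃ C : ℕ, ∀ ℓ δ L, IsWindow ℓ δ L →
      FC (cgF (ℓ := ℓ) (fun p t => scanW δ L (p + (δ : ZMod ℓ)) t) (lg h)) (C * ℓ ^ 2) := by
    intro h
    obtain ⟨g, hg, hg'⟩ := exists_lg_perm h
    rw [← hg']
    exact alternatingGroup_le_controllable hg
  choose C hC using key
  refine ⟨∑ h, C h, fun h hh ℓ δ L hw => ?_⟩
  refine (hC (Equiv.ofBijective h hh) ℓ δ L hw).mono (Nat.mul_le_mul_right _ ?_)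
  exact Finset.single_le_sum (f := C) (fun _ _ => Nat.zero_le _) (Finset.mem_univ _)

/-- The side of an arrow. -/
def sd : Arrow → ℤ
  | .rf => -1
  | .lf => 1
  | .rh => 1
  | .lh => -1

theorem sd_eq (a : Arrow) : sd a = 1 ∨ sd a = -1 := by cases a <;> simp [sd]

theorem sd_natAbs (a : Arrow) : (sd a).natAbs = 1 := by cases a <;> rfl

/-- The constant of controlled gates. -/
noncomputable def ctlC : ℕ := exists_controlled_lg.choose

theorem FC.controlled {h : Arrow × Fin 2 × Letter → Arrow × Fin 2 × Letter}
    (hh : Function.Bijective h) {ℓ : ℕ} {δ : ℤ} {L : List (Set Letter × Set Letter)}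
    (hw : IsWindow ℓ δ L) :
    FC (cgF (ℓ := ℓ) (fun p t => scanW δ L (p + (δ : ZMod ℓ)) t) (_root_.lg h)) (ctlC * ℓ ^ 2) :=
  exists_controlled_lg.choose_spec h hh ℓ δ L hw

/-- The cell at distance `k` from the head, in the direction of its side. -/
def cel {ℓ : ℕ} (k : ℕ) (x : HC ℓ) : ZMod ℓ := x.p + (sd x.q.1.1 : ZMod ℓ) * k

/-- Apply a gate to the state and the letter of the cell at distance `k`. -/
def cellF {ℓ : ℕ} (k : ℕ) (g : DQ × Letter → DQ × Letter) (x : HC ℓ) : HC ℓ :=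
  ⟨x.p, (g (x.q, x.t (cel k x))).1, Function.update x.t (cel k x) (g (x.q, x.t (cel k x))).2⟩

open Classical in
/-- Apply a logical gate to the cell at distance `k` if scanning the window that starts next to
that cell, in direction `ε` relative to the side, succeeds. -/
noncomputable def ccellF {ℓ : ℕ} (k : ℕ) (ε : ℤ) (L : List (Set Letter × Set Letter))
    (h : Arrow × Fin 2 × Letter → Arrow × Fin 2 × Letter) (x : HC ℓ) : HC ℓ :=
  if scanW (ε * sd x.q.1.1) L (cel k x + ((ε * sd x.q.1.1 : ℤ) : ZMod ℓ)) x.t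
  then cellF k (lg h) x else x

/-- Oriented shift by `k` cells. -/
theorem FC.oshift {ℓ : ℕ} (k : ℕ) :
    FC (ℓ := ℓ) (shiftF fun q => sd q.1.1 * k) (96 * k) :=
  FC.shift _ k fun q => by rw [Int.natAbs_mul, sd_natAbs, Int.natAbs_natCast, one_mul]

theorem FC.oshift_neg {ℓ : ℕ} (k : ℕ) :
    FC (ℓ := ℓ) (shiftF fun q => -(sd q.1.1 * k)) (96 * k) :=
  (FC.oshift k).inv fun x => shiftF_inv _ x

theorem FC.cell {ℓ : ℕ} {k : ℕ} {g : DQ × Letter → DQ × Letter} (hg : Function.Bijective g)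
    (hs : ∀ u, sd (g u).1.1.1 = sd u.1.1.1) (hk : k ≤ ℓ) (h1 : 1 ≤ ℓ) :
    FC (ℓ := ℓ) (cellF k g) (193 * ℓ) := by
  refine (((FC.oshift_neg k).comp (FC.gate_fun g hg)).comp (FC.oshift k)).mono (by omega)
    |>.of_eq fun x => ?_
  simp [cellF, shiftF, gateF, hs, cel]

/-- The restriction of a logical gate to arrows of side `s`. -/
def onSide (s : ℤ) (h : Arrow × Fin 2 × Letter → Arrow × Fin 2 × Letter)
    (u : Arrow × Fin 2 × Letter) : Arrow × Fin 2 × Letter := if sd u.1 = s then h u else u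

theorem onSide_bijective (s : ℤ) {h : Arrow × Fin 2 × Letter → Arrow × Fin 2 × Letter}
    (hh : Function.Bijective h) (hs : ∀ u, sd (h u).1 = sd u.1) :
    Function.Bijective (onSide s h) := by
  rw [← Finite.injective_iff_bijective]
  intro u v huv
  unfold onSide at huv
  split_ifs at huv with h1 h2 h2
  · exact hh.1 huv
  · rw [← huv, hs] at h2; exact absurd h1 h2
  · rw [huv, hs] at h1; exact absurd h2 h1
  · exact huv

/-- The cost constant of controlled cell gates. -/
noncomputable def cc : ℕ := 2 * ctlC + 193

theorem FC.ccell {ℓ : ℕ} {k : ℕ} {ε : ℤ} {L : List (Set Letter × Set Letter)}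
    {h : Arrow × Fin 2 × Letter → Arrow × Fin 2 × Letter} (hh : Function.Bijective h)
    (hs : ∀ u, sd (h u).1 = sd u.1) (hk : k ≤ ℓ) (h2 : 2 ≤ ℓ) (hε : ε.natAbs = 1)
    (hd : ∀ e ∈ L, Disjoint e.1 e.2) (hL : L.length < ℓ) :
    FC (ℓ := ℓ) (ccellF k ε L h) (cc * ℓ ^ 2) := by
  have hw : ∀ s : ℤ, s.natAbs = 1 → IsWindow ℓ (ε * s) L := fun s hs' =>
    ⟨h2, by rw [Int.natAbs_mul, hε, hs'], hd, hL⟩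
  refine ((((FC.oshift_neg k).comp (FC.controlled (onSide_bijective 1 hh hs) (hw 1 rfl))).comp
    (FC.controlled (onSide_bijective (-1) hh hs) (hw (-1) rfl))).comp (FC.oshift k)).mono ?_
    |>.of_eq fun x => ?_
  · unfold cc
    nlinarith
  · have hid : ∀ (s : ℤ) (y : HC ℓ), sd y.q.1.1 ≠ s → gateF (_root_.lg (onSide s h)) y = y := by
      intro s y hy
      simp [gateF, _root_.lg, onSide, hy]
    have hh' : ∀ (s : ℤ) (y : HC ℓ), sd y.q.1.1 = s →
        gateF (_root_.lg (onSide s h)) y = gateF (_root_.lg h) y := by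
      intro s y hy
      simp [gateF, _root_.lg, onSide, hy]
    have hsd : ∀ y : HC ℓ, sd (gateF (_root_.lg h) y).q.1.1 = sd y.q.1.1 := fun y => hs _
    have ep : (shiftF (fun q => sd q.1.1 * (k : ℤ)) x).p = cel k x := by
      simp [shiftF, cel]
    have hfin : shiftF (fun q => -(sd q.1.1 * (k : ℤ)))
        (gateF (_root_.lg h) (shiftF (fun q => sd q.1.1 * (k : ℤ)) x)) =
        cellF k (_root_.lg h) x := by
      simp [cellF, shiftF, gateF, _root_.lg, hs, cel]
    have hfin' : shiftF (fun q => -(sd q.1.1 * (k : ℤ)))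
        (shiftF (fun q => sd q.1.1 * (k : ℤ)) x) = x := shiftF_inv _ x
    simp only [Function.comp_apply, ccellF]
    generalize hy : shiftF (fun q => sd q.1.1 * (k : ℤ)) x = y at *
    have hyq : y.q = x.q := by rw [← hy]; rfl
    have hyt : y.t = x.t := by rw [← hy]; rfl
    rw [← hyq, ← ep, ← hyt]
    rcases sd_eq y.q.1.1 with h1 | h1
    · rw [h1]
      have hstep : cgF (fun p t => scanW (ε * -1) L (p + ((ε * -1 : ℤ) : ZMod ℓ)) t)
          (_root_.lg (onSide (-1) h)) y = y := by
        simp only [cgF]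
        rw [hid (-1) y (by rw [h1]; decide), ite_self]
      rw [hstep]
      simp only [cgF, hh' 1 y h1]
      split_ifs
      · exact hfin.symm
      · exact hfin'.symm
    · rw [h1]
      have hstep : ∀ z : HC ℓ, sd z.q.1.1 = -1 →
          cgF (fun p t => scanW (ε * 1) L (p + ((ε * 1 : ℤ) : ZMod ℓ)) t)
          (_root_.lg (onSide 1 h)) z = z := by
        intro z hz
        simp only [cgF]
        rw [hid 1 z (by rw [hz]; decide), ite_self]
      rw [hstep]
      · simp only [cgF, hh' (-1) y h1]
        split_ifs
        · exact hfin.symm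
        · exact hfin'.symm
      · simp only [cgF, hh' (-1) y h1]
        split_ifs
        · rw [hsd, h1]
        · exact h1

/-- A configuration from its arrow, duck, passive data, position and tape. -/
def cf {ℓ : ℕ} (p : ZMod ℓ) (a : Arrow) (d : Fin 2) (r : Fin 2 × Fin 6) (t : ZMod ℓ → Letter) :
    HC ℓ := ⟨p, ((a, r.1), (d, r.2)), t⟩

theorem exists_cf {ℓ : ℕ} (x : HC ℓ) : ∃ p a d r t, x = cf p a d r t :=
  ⟨x.p, x.q.1.1, x.q.2.1, (x.q.1.2, x.q.2.2), x.t, rfl⟩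

theorem cellF_cf {ℓ : ℕ} (k : ℕ) (h : Arrow × Fin 2 × Letter → Arrow × Fin 2 × Letter)
    (p : ZMod ℓ) (a : Arrow) (d : Fin 2) (r : Fin 2 × Fin 6) (t : ZMod ℓ → Letter) :
    cellF k (lg h) (cf p a d r t) =
      cf p (h (a, d, t (p + sd a * k))).1 (h (a, d, t (p + sd a * k))).2.1 r
        (Function.update t (p + sd a * k) (h (a, d, t (p + sd a * k))).2.2) := rfl

open Classical in
theorem ccellF_cf {ℓ : ℕ} (k : ℕ) (ε : ℤ) (L : List (Set Letter × Set Letter))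
    (h : Arrow × Fin 2 × Letter → Arrow × Fin 2 × Letter)
    (p : ZMod ℓ) (a : Arrow) (d : Fin 2) (r : Fin 2 × Fin 6) (t : ZMod ℓ → Letter) :
    ccellF k ε L h (cf p a d r t) =
      if scanW (ε * sd a) L (p + (sd a : ZMod ℓ) * (k : ZMod ℓ) + ((ε * sd a : ℤ) : ZMod ℓ)) t then
        cellF k (lg h) (cf p a d r t) else cf p a d r t := rfl

/-- The distance from `p` to `i` in direction `s`. -/
def off {ℓ : ℕ} (p : ZMod ℓ) (s : ℤ) (i : ZMod ℓ) : ℕ := ((s : ZMod ℓ) * (i - p)).val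

theorem cast_mul_self {ℓ : ℕ} {s : ℤ} (hs : s = 1 ∨ s = -1) : (s : ZMod ℓ) * s = 1 := by
  rcases hs with rfl | rfl <;> simp

theorem off_add {ℓ : ℕ} (p : ZMod ℓ) {s : ℤ} (hs : s = 1 ∨ s = -1) {j : ℕ} (hj : j < ℓ) :
    off p s (p + s * j) = j := by
  rw [off, add_sub_cancel_left, ← mul_assoc, cast_mul_self hs, one_mul, ZMod.val_natCast,
    Nat.mod_eq_of_lt hj]

theorem add_off {ℓ : ℕ} [NeZero ℓ] (p : ZMod ℓ) {s : ℤ} (hs : s = 1 ∨ s = -1) (i : ZMod ℓ) :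
    p + s * (off p s i : ℕ) = i := by
  rw [off, ZMod.natCast_val, ZMod.cast_id', id, ← mul_assoc, cast_mul_self hs]
  ring

theorem off_lt {ℓ : ℕ} [NeZero ℓ] (p : ZMod ℓ) (s : ℤ) (i : ZMod ℓ) : off p s i < ℓ :=
  ZMod.val_lt _

theorem tape_ext {ℓ : ℕ} [NeZero ℓ] {α : Type*} (p : ZMod ℓ) {s : ℤ} (hs : s = 1 ∨ s = -1)
    {t t' : ZMod ℓ → α} (h : ∀ j < ℓ, t (p + s * j) = t' (p + s * j)) : t = t' := by
  funext i
  rw [← add_off p hs i]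
  exact h _ (off_lt p s i)

theorem add_mul_inj {ℓ : ℕ} (p : ZMod ℓ) {s : ℤ} (hs : s = 1 ∨ s = -1) {i j : ℕ} (hi : i < ℓ)
    (hj : j < ℓ) : p + (s : ZMod ℓ) * i = p + s * j ↔ i = j := by
  refine ⟨fun h => ?_, fun h => by rw [h]⟩
  rw [← off_add p hs hi, h, off_add p hs hj]

theorem update_off {ℓ : ℕ} {α : Type*} (p : ZMod ℓ) {s : ℤ} (hs : s = 1 ∨ s = -1) {j k : ℕ}
    (hj : j < ℓ) (hk : k < ℓ) (t : ZMod ℓ → α) (b : α) :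
    Function.update t (p + s * k) b (p + s * j) = if j = k then b else t (p + s * j) := by
  simp only [Function.update_apply, add_mul_inj p hs hj hk]

/-- The ternary digit of `N` at position `j`. -/
def dg (N j : ℕ) : Letter := ⟨N / 3 ^ j % 3, Nat.mod_lt _ (by norm_num)⟩

/-- Write the `k` lowest digits of `N` next to `p` in direction `s`. -/
def wr {ℓ : ℕ} (p : ZMod ℓ) (s : ℤ) (k N : ℕ) (t : ZMod ℓ → Letter) (i : ZMod ℓ) : Letter :=
  if off p s i < k then dg N (off p s i) else t i

section wr

variable {ℓ : ℕ} (p : ZMod ℓ) {s : ℤ}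

theorem wr_apply (hs : s = 1 ∨ s = -1) {j : ℕ} (hj : j < ℓ) (k N : ℕ)
    (t : ZMod ℓ → Letter) :
    wr p s k N t (p + s * j) = if j < k then dg N j else t (p + s * j) := by
  rw [wr, off_add p hs hj]

theorem wr_zero (N : ℕ) (t : ZMod ℓ → Letter) : wr p s 0 N t = t := by
  funext i; simp [wr]

theorem wr_succ [NeZero ℓ] (hs : s = 1 ∨ s = -1) {k : ℕ} (hk : k < ℓ) (N : ℕ)
    (t : ZMod ℓ → Letter) :
    wr p s (k + 1) N t = wr p s k N (Function.update t (p + s * k) (dg N k)) := by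
  refine tape_ext p hs fun j hj => ?_
  rw [wr_apply p hs hj, wr_apply p hs hj, update_off p hs hj hk]
  split_ifs <;> first | omega | simp_all

theorem update_wr [NeZero ℓ] (hs : s = 1 ∨ s = -1) {k j : ℕ} (hkj : k ≤ j) (hj : j < ℓ)
    (N : ℕ) (t : ZMod ℓ → Letter) (b : Letter) :
    Function.update (wr p s k N t) (p + s * j) b =
      wr p s k N (Function.update t (p + s * j) b) := by
  refine tape_ext p hs fun i hi => ?_
  rw [wr_apply p hs hi, update_off p hs hi hj, update_off p hs hi hj,
    wr_apply p hs hi]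
  split_ifs <;> first | omega | rfl

theorem wr_congr (k : ℕ) {N N' : ℕ} (h : N % 3 ^ k = N' % 3 ^ k) (t : ZMod ℓ → Letter) :
    wr p s k N t = wr p s k N' t := by
  funext i
  unfold wr
  split_ifs with hi
  · have key : ∀ M : ℕ, M / 3 ^ off p s i % 3 = M % 3 ^ k / 3 ^ off p s i % 3 := by
      intro M
      obtain ⟨c, hc⟩ := Nat.exists_eq_add_of_lt hi
      rw [hc, add_assoc, pow_add, Nat.mod_mul_right_div_self, pow_succ, Nat.mod_mul_left_mod]
    simp only [dg]
    rw [Fin.mk.injEq, key N, key N', h]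
  · rfl

theorem wr_irrel (k N : ℕ) {t t' : ZMod ℓ → Letter} (h : ∀ i, k ≤ off p s i → t i = t' i) :
    wr p s k N t = wr p s k N t' := by
  funext i
  unfold wr
  split_ifs with hi
  · rfl
  · exact h i (not_lt.1 hi)

end wr

/-- The carry into position `j` when adding `a`. -/
def carryList (a : ℕ) : ℕ → List (Set Letter × Set Letter)
  | 0 => []
  | j + 1 => ({l | l.val + (dg a j).val = 2}, {l | 3 ≤ l.val + (dg a j).val}) :: carryList a j

theorem length_carryList (a j : ℕ) : (carryList a j).length = j := by
  induction j with
  | zero => rfl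
  | succ j ih => simp [carryList, ih]

theorem disjoint_carryList (a j : ℕ) : ∀ e ∈ carryList a j, Disjoint e.1 e.2 := by
  induction j with
  | zero => simp [carryList]
  | succ j ih =>
    intro e he
    rcases List.mem_cons.1 he with rfl | he
    · rw [Set.disjoint_left]
      intro l h1 h2
      simp only [Set.mem_ofPred_eq] at h1 h2
      omega
    · exact ih e he

theorem mod_pow_succ_eq (N j : ℕ) : N % 3 ^ (j + 1) = N % 3 ^ j + 3 ^ j * (dg N j).val := by
  rw [pow_succ, Nat.mod_mul]
  rfl

theorem carry_succ (N a j : ℕ) : 3 ^ (j + 1) ≤ N % 3 ^ (j + 1) + a % 3 ^ (j + 1) ↔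
    3 ≤ (dg N j).val + (dg a j).val ∨
      ((dg N j).val + (dg a j).val = 2 ∧ 3 ^ j ≤ N % 3 ^ j + a % 3 ^ j) := by
  rw [mod_pow_succ_eq, mod_pow_succ_eq, pow_succ]
  have h1 := Nat.mod_lt N (show 0 < 3 ^ j by positivity)
  have h2 := Nat.mod_lt a (show 0 < 3 ^ j by positivity)
  generalize hM : 3 ^ j = M at *
  generalize hS : (dg N j).val = u
  generalize hS' : (dg a j).val = v
  constructor
  · intro h
    by_contra! hcon
    obtain ⟨hc1, hc2⟩ := hcon
    rcases Nat.lt_or_ge (u + v) 2 with h5 | h5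
    · have : M * (u + v) ≤ M * 1 := Nat.mul_le_mul_left _ (by omega)
      rw [mul_add] at this
      omega
    · have h6 := hc2 (by omega)
      have : M * (u + v) = M * 2 := by rw [show u + v = 2 by omega]
      rw [mul_add] at this
      omega
  · rintro (h | ⟨h, h'⟩)
    · have : M * 3 ≤ M * (u + v) := Nat.mul_le_mul_left _ h
      rw [mul_add] at this
      omega
    · have : M * (u + v) = M * 2 := by rw [h]
      rw [mul_add] at this
      omega

theorem dg_add (N a j : ℕ) : dg (N + a) j =
    dg N j + dg a j + if 3 ^ j ≤ N % 3 ^ j + a % 3 ^ j then 1 else 0 := by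
  have h : (N + a) / 3 ^ j = N / 3 ^ j + a / 3 ^ j +
      if 3 ^ j ≤ N % 3 ^ j + a % 3 ^ j then 1 else 0 :=
    Nat.add_div (by positivity)
  apply Fin.ext
  simp only [dg, h]
  split_ifs <;> simp [Fin.val_add, Nat.add_mod]

theorem scanW_carryList {ℓ : ℕ} (p : ZMod ℓ) {s : ℤ} (hs : s = 1 ∨ s = -1) (a N : ℕ) {k j : ℕ}
    (hj : j ≤ k) (hjl : j ≤ ℓ) (t : ZMod ℓ → Letter) :
    scanW (-1 * s) (carryList a j) (p + (s : ZMod ℓ) * (j : ZMod ℓ) + ((-1 * s : ℤ) : ZMod ℓ)) (wr p s k N t) ↔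
      3 ^ j ≤ N % 3 ^ j + a % 3 ^ j := by
  induction j with
  | zero => simp [carryList, scanW, Nat.mod_one]
  | succ j ih =>
    have e : p + (s : ZMod ℓ) * ((j + 1 : ℕ) : ZMod ℓ) + ((-1 * s : ℤ) : ZMod ℓ) = p + s * j := by
      push_cast; ring
    rw [e, carryList, scanW, ih (by omega) (by omega), carry_succ, wr_apply p hs (by omega),
      if_pos (by omega)]
    rfl

/-- Add `c` to the letter, for states in the mask `μ`. -/
def addH (μ : Arrow → Fin 2 → Bool) (c : Letter) (u : Arrow × Fin 2 × Letter) :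
    Arrow × Fin 2 × Letter := (u.1, u.2.1, if μ u.1 u.2.1 then u.2.2 + c else u.2.2)

theorem addH_bijective (μ : Arrow → Fin 2 → Bool) (c : Letter) :
    Function.Bijective (addH μ c) := by
  rw [← Finite.injective_iff_bijective]
  rintro ⟨a, d, l⟩ ⟨a', d', l'⟩ h
  simp only [addH, Prod.mk.injEq] at h
  obtain ⟨rfl, rfl, h⟩ := h
  split_ifs at h <;> simp_all

/-- Add `a` to the number written in the `k` cells next to the head, for states in `μ`. -/
noncomputable def addF {ℓ : ℕ} (μ : Arrow → Fin 2 → Bool) (a : ℕ) : ℕ → HC ℓ → HC ℓ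
  | 0 => id
  | k + 1 => addF μ a k ∘ ccellF k (-1) (carryList a k) (addH μ 1) ∘
      cellF k (lg (addH μ (dg a k)))

theorem lg_bijective {h : Arrow × Fin 2 × Letter → Arrow × Fin 2 × Letter}
    (hh : Function.Bijective h) : Function.Bijective (lg h) := by
  obtain ⟨g, _, hg⟩ := exists_lg_perm (Equiv.ofBijective h hh)
  rw [show lg h = g from hg.symm]
  exact g.bijective

theorem FC.lcell {ℓ : ℕ} {k : ℕ} {h : Arrow × Fin 2 × Letter → Arrow × Fin 2 × Letter}
    (hh : Function.Bijective h) (hs : ∀ u, sd (h u).1 = sd u.1) (hk : k ≤ ℓ) (h1 : 1 ≤ ℓ) :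
    FC (ℓ := ℓ) (cellF k (_root_.lg h)) (193 * ℓ) :=
  FC.cell (lg_bijective hh) (fun _ => hs _) hk h1

theorem FC.add {ℓ : ℕ} (h2 : 2 ≤ ℓ) (μ : Arrow → Fin 2 → Bool) (a : ℕ) {k : ℕ} (hk : k ≤ ℓ) :
    FC (ℓ := ℓ) (addF μ a k) (k * ((cc + 193) * ℓ ^ 2)) := by
  induction k with
  | zero => simpa [addF] using FC.id
  | succ k ih =>
    refine ((ih (by omega)).comp ((FC.ccell (addH_bijective μ 1) (fun _ => rfl) (by omega) h2 rfl
      (disjoint_carryList a k) (by rw [length_carryList]; omega)).comp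
      (FC.lcell (addH_bijective μ (dg a k)) (fun _ => rfl) (by omega) (by omega)))).mono ?_
    rw [Nat.succ_mul]
    have : ℓ ≤ ℓ ^ 2 := Nat.le_self_pow (by norm_num) ℓ
    nlinarith

theorem addF_of_mem {ℓ : ℕ} [NeZero ℓ] (μ : Arrow → Fin 2 → Bool) (a N : ℕ) {k : ℕ} (hk : k ≤ ℓ)
    (p : ZMod ℓ) {b : Arrow} {d : Fin 2} (hμ : μ b d = true) (r : Fin 2 × Fin 6)
    (t : ZMod ℓ → Letter) :
    addF μ a k (cf p b d r (wr p (sd b) k N t)) = cf p b d r (wr p (sd b) k (N + a) t) := by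
  induction k generalizing t with
  | zero => simp [addF, wr_zero]
  | succ k ih =>
    have hs := sd_eq b
    have hscan := scanW_carryList p hs a N (le_refl k) (by omega)
      (Function.update t (p + sd b * k) (dg N k + dg a k))
    rw [addF, Function.comp_apply, Function.comp_apply, cellF_cf]
    simp only [addH, hμ, if_true]
    rw [wr_apply p hs (by omega), if_pos (by omega), wr_succ p hs (by omega),
      update_wr p hs le_rfl (by omega), Function.update_idem, ccellF_cf]
    rw [wr_succ p hs (by omega), dg_add]
    by_cases hc : 3 ^ k ≤ N % 3 ^ k + a % 3 ^ k
    · rw [if_pos (hscan.2 hc), if_pos hc, cellF_cf]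
      simp only [addH, hμ, if_true]
      rw [wr_apply p hs (by omega), if_neg (by omega), Function.update_self,
        update_wr p hs le_rfl (by omega), Function.update_idem, ih (by omega)]
    · rw [if_neg (fun h => hc (hscan.1 h)), if_neg hc, add_zero, ih (by omega)]

theorem addF_of_notMem {ℓ : ℕ} (μ : Arrow → Fin 2 → Bool) (a k : ℕ)
    (p : ZMod ℓ) {b : Arrow} {d : Fin 2} (hμ : μ b d = false) (r : Fin 2 × Fin 6)
    (t : ZMod ℓ → Letter) :
    addF μ a k (cf p b d r t) = cf p b d r t := by
  induction k with
  | zero => simp [addF]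
  | succ k ih => simp [addF, cellF_cf, ccellF_cf, addH, hμ, ih]

/-- The trit of a ghost. -/
def tri (x : Fin 6) : Letter := ⟨x % 3, Nat.mod_lt _ (by norm_num)⟩

/-- Replace the trit of a ghost. -/
def mix (x : Fin 6) (l : Letter) : Fin 6 := ⟨3 * (x / 3) + l, by omega⟩

theorem tri_mix (x : Fin 6) (l : Letter) : tri (mix x l) = l := by
  revert x l; decide

theorem mix_mix (x : Fin 6) (l l' : Letter) : mix (mix x l) l' = mix x l' := by
  revert x l l'; decide

theorem mix_tri (x : Fin 6) : mix x (tri x) = x := by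
  revert x; decide

/-- Exchange the trit of the ghost with the letter, for states in the mask. -/
def xg (μ : Arrow → Fin 2 → Bool) (u : DQ × Letter) : DQ × Letter :=
  if μ u.1.1.1 u.1.2.1 then ((u.1.1, u.1.2.1, mix u.1.2.2 u.2), tri u.1.2.2) else u

theorem xg_bijective (μ : Arrow → Fin 2 → Bool) : Function.Bijective (xg μ) := by
  apply Function.Involutive.bijective
  intro u
  by_cases h : μ u.1.1.1 u.1.2.1 <;> simp [xg, h, tri_mix, mix_mix, mix_tri]

theorem sd_xg (μ : Arrow → Fin 2 → Bool) (u : DQ × Letter) : sd (xg μ u).1.1.1 = sd u.1.1.1 := by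
  unfold xg
  split_ifs <;> rfl

theorem gateF_xg {ℓ : ℕ} {μ : Arrow → Fin 2 → Bool} {p : ZMod ℓ} {a : Arrow} {d : Fin 2}
    (hμ : μ a d = true) (r : Fin 2 × Fin 6) (t : ZMod ℓ → Letter) :
    gateF (xg μ) (cf p a d r t) =
      cf p a d (r.1, mix r.2 (t p)) (Function.update t p (tri r.2)) := by
  simp [gateF, xg, cf, hμ]

theorem cellF_xg {ℓ : ℕ} {μ : Arrow → Fin 2 → Bool} {p : ZMod ℓ} {a : Arrow} {d : Fin 2}
    (hμ : μ a d = true) (k : ℕ) (r : Fin 2 × Fin 6) (t : ZMod ℓ → Letter) :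
    cellF k (xg μ) (cf p a d r t) =
      cf p a d (r.1, mix r.2 (t (p + sd a * k))) (Function.update t (p + sd a * k) (tri r.2)) := by
  simp [cellF, xg, cf, hμ, cel]

theorem cellF_xg_of_notMem {ℓ : ℕ} {μ : Arrow → Fin 2 → Bool} {p : ZMod ℓ} {a : Arrow} {d : Fin 2}
    (hμ : μ a d = false) (k : ℕ) (r : Fin 2 × Fin 6) (t : ZMod ℓ → Letter) :
    cellF k (xg μ) (cf p a d r t) = cf p a d r t := by
  simp [cellF, xg, cf, hμ, cel]

/-- Exchange the letters at distances `i` and `j`. -/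
def swF {ℓ : ℕ} (μ : Arrow → Fin 2 → Bool) (i j : ℕ) : HC ℓ → HC ℓ :=
  cellF i (xg μ) ∘ cellF j (xg μ) ∘ cellF i (xg μ)

theorem FC.sw {ℓ : ℕ} (h1 : 1 ≤ ℓ) (μ : Arrow → Fin 2 → Bool) {i j : ℕ} (hi : i ≤ ℓ) (hj : j ≤ ℓ) :
    FC (ℓ := ℓ) (swF μ i j) (579 * ℓ) :=
  ((FC.cell (xg_bijective μ) (sd_xg μ) hi h1).comp ((FC.cell (xg_bijective μ) (sd_xg μ) hj h1).comp
    (FC.cell (xg_bijective μ) (sd_xg μ) hi h1))).mono (by omega)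

theorem swF_of_mem {ℓ : ℕ} {μ : Arrow → Fin 2 → Bool} {p : ZMod ℓ} {a : Arrow} {d : Fin 2}
    (hμ : μ a d = true) {i j : ℕ} (hi : i < ℓ) (hj : j < ℓ) (hij : i ≠ j) (r : Fin 2 × Fin 6)
    (t : ZMod ℓ → Letter) :
    swF μ i j (cf p a d r t) = cf p a d r (Function.update (Function.update t (p + sd a * i)
      (t (p + sd a * j))) (p + sd a * j) (t (p + sd a * i))) := by
  have hs := sd_eq a
  simp only [swF, Function.comp_apply, cellF_xg hμ, update_off p hs hi hj, update_off p hs hj hi,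
    if_neg hij, if_neg hij.symm, tri_mix, mix_mix, mix_tri, Function.update_self]
  rw [Function.update_comm, Function.update_idem, Function.update_comm]
  · rw [Ne, add_mul_inj p hs hi hj]; exact hij
  · rw [Ne, add_mul_inj p hs hj hi]; exact hij.symm

/-- Exchange the letters at distances `i` and `k - i` for all `i < r`. -/
def revAux {ℓ : ℕ} (μ : Arrow → Fin 2 → Bool) (k : ℕ) : ℕ → HC ℓ → HC ℓ
  | 0 => id
  | r + 1 => swF μ r (k - r) ∘ revAux μ k r

/-- Reverse the word in the cells at distances `0, …, k`. -/
def revF {ℓ : ℕ} (μ : Arrow → Fin 2 → Bool) (k : ℕ) : HC ℓ → HC ℓ := revAux μ k ((k + 1) / 2)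

theorem FC.rev {ℓ : ℕ} (h1 : 1 ≤ ℓ) (μ : Arrow → Fin 2 → Bool) {k : ℕ} (hk : k < ℓ) :
    FC (ℓ := ℓ) (revF μ k) (579 * ℓ ^ 2) := by
  have key : ∀ r ≤ k + 1, FC (ℓ := ℓ) (revAux μ k r) (r * (579 * ℓ)) := by
    intro r hr
    induction r with
    | zero => simpa [revAux] using FC.id
    | succ r ih =>
      refine ((FC.sw h1 μ (i := r) (j := k - r) (by omega) (by omega)).comp (ih (by omega))).mono ?_
      nlinarith
  refine (key ((k + 1) / 2) (by omega)).mono ?_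
  have : (k + 1) / 2 ≤ ℓ := by omega
  nlinarith

theorem revF_of_notMem {ℓ : ℕ} {μ : Arrow → Fin 2 → Bool} {p : ZMod ℓ} {a : Arrow} {d : Fin 2}
    (hμ : μ a d = false) (k : ℕ) (r : Fin 2 × Fin 6) (t : ZMod ℓ → Letter) :
    revF μ k (cf p a d r t) = cf p a d r t := by
  unfold revF
  induction (k + 1) / 2 with
  | zero => rfl
  | succ n ih => simp [revAux, ih, swF, cellF_xg_of_notMem hμ]

theorem revF_of_mem {ℓ : ℕ} [NeZero ℓ] {μ : Arrow → Fin 2 → Bool} {p : ZMod ℓ} {a : Arrow}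
    {d : Fin 2} (hμ : μ a d = true) {k : ℕ} (hk : k < ℓ) (r : Fin 2 × Fin 6)
    (t t' : ZMod ℓ → Letter)
    (ht : ∀ j < ℓ, t' (p + sd a * j) =
      if j ≤ k then t (p + sd a * (k - j : ℕ)) else t (p + sd a * j)) :
    revF μ k (cf p a d r t) = cf p a d r t' := by
  have hs := sd_eq a
  have key : ∀ n ≤ (k + 1) / 2, ∃ t'' : ZMod ℓ → Letter,
      revAux μ k n (cf p a d r t) = cf p a d r t'' ∧ ∀ j < ℓ, t'' (p + sd a * j) =
        if j ≤ k ∧ (j < n ∨ k < j + n) then t (p + sd a * (k - j : ℕ)) else t (p + sd a * j) := by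
    intro n hn
    induction n with
    | zero =>
      refine ⟨t, rfl, fun j hj => ?_⟩
      rw [if_neg (by omega)]
    | succ n ih =>
      obtain ⟨t'', h1, h2⟩ := ih (by omega)
      refine ⟨_, by rw [revAux, Function.comp_apply, h1,
        swF_of_mem hμ (by omega) (by omega) (by omega)], fun j hj => ?_⟩
      rw [update_off p hs hj (by omega), update_off p hs hj (by omega), h2 j hj,
        h2 n (by omega), h2 (k - n) (by omega)]
      rcases Nat.lt_trichotomy j n with h | rfl | h
      · rw [if_neg (by omega), if_neg (by omega), if_pos (by omega), if_pos (by omega)]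
      · rw [if_neg (by omega), if_pos rfl, if_neg (by omega), if_pos (by omega)]
      · by_cases h3 : j = k - n
        · rw [if_pos h3, if_neg (by omega), if_pos (by omega), show k - j = n by omega]
        · rw [if_neg h3, if_neg (by omega)]
          split_ifs <;> first | rfl | omega
  obtain ⟨t'', h1, h2⟩ := key _ le_rfl
  rw [revF, h1]
  congr 1
  refine tape_ext p hs fun j hj => ?_
  rw [h2 j hj, ht j hj]
  by_cases h : j ≤ k
  · rw [if_pos h]
    split_ifs with h3
    · rfl
    · rw [show k - j = j by omega]
  · rw [if_neg h, if_neg (by omega)]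

/-- Move the head one cell in the direction of its side, for states in the mask. -/
def mstep {ℓ : ℕ} (μ : Arrow → Fin 2 → Bool) : HC ℓ → HC ℓ :=
  shiftF fun q => if μ q.1.1 q.2.1 then sd q.1.1 else 0

/-- Rotate the configuration one cell in the direction of the side, for states in the mask. -/
def rotF {ℓ : ℕ} (μ : Arrow → Fin 2 → Bool) : HC ℓ → HC ℓ :=
  (mstep μ ∘ gateF (xg μ))^[ℓ + 1]

theorem FC.rot {ℓ : ℕ} (h1 : 1 ≤ ℓ) (μ : Arrow → Fin 2 → Bool) :
    FC (ℓ := ℓ) (rotF μ) (194 * ℓ) := by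
  have : FC (ℓ := ℓ) (mstep μ) (96 * 1) := FC.shift _ 1 fun q => by
    split_ifs
    · exact (sd_natAbs _).le
    · simp
  exact ((this.comp (FC.gate_fun _ (xg_bijective μ))).iterate (ℓ + 1)).mono (by omega)

theorem rotF_of_notMem {ℓ : ℕ} {μ : Arrow → Fin 2 → Bool} {p : ZMod ℓ} {a : Arrow} {d : Fin 2}
    (hμ : μ a d = false) (r : Fin 2 × Fin 6) (t : ZMod ℓ → Letter) :
    rotF μ (cf p a d r t) = cf p a d r t := by
  apply Function.iterate_fixed
  simp [mstep, shiftF, gateF, xg, cf, hμ]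

theorem mstep_of_mem {ℓ : ℕ} {μ : Arrow → Fin 2 → Bool} {p : ZMod ℓ} {a : Arrow} {d : Fin 2}
    (hμ : μ a d = true) (r : Fin 2 × Fin 6) (t : ZMod ℓ → Letter) :
    mstep μ (cf p a d r t) = cf (p + (sd a : ZMod ℓ)) a d r t := by
  simp [mstep, shiftF, cf, hμ]

theorem rotF_of_mem {ℓ : ℕ} [NeZero ℓ] {μ : Arrow → Fin 2 → Bool} {p : ZMod ℓ} {a : Arrow}
    {d : Fin 2} (hμ : μ a d = true) (r : Fin 2 × Fin 6) (t : ZMod ℓ → Letter) :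
    rotF μ (cf p a d r t) = cf (p + (sd a : ZMod ℓ)) a d r (fun i => t (i - (sd a : ZMod ℓ))) := by
  have hs := sd_eq a
  let v : ℕ → Letter := fun n => if n = 0 then tri r.2 else t (p + sd a * (n - 1 : ℕ))
  have key : ∀ n ≤ ℓ, ∃ t' : ZMod ℓ → Letter, (mstep μ ∘ gateF (xg μ))^[n] (cf p a d r t) =
      cf (p + (sd a : ZMod ℓ) * (n : ZMod ℓ)) a d (r.1, mix r.2 (v n)) t' ∧
      ∀ j < ℓ, t' (p + sd a * j) = if j < n then v j else t (p + sd a * j) := by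
    intro n hn
    induction n with
    | zero => exact ⟨t, by simp [v, mix_tri], by simp⟩
    | succ n ih =>
      obtain ⟨t', h1, h2⟩ := ih (by omega)
      refine ⟨Function.update t' (p + sd a * n) (v n), ?_, fun j hj => ?_⟩
      · rw [Function.iterate_succ_apply', h1, Function.comp_apply, gateF_xg hμ, mstep_of_mem hμ]
        simp only [tri_mix, mix_mix]
        rw [h2 n (by omega), if_neg (by omega)]
        simp only [v, Nat.succ_ne_zero, if_false, Nat.add_sub_cancel]
        congr 1
        push_cast
        ring
      · rw [update_off p hs hj (by omega), h2 j hj]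
        rcases Nat.lt_trichotomy j n with h | rfl | h
        · rw [if_neg (by omega), if_pos (by omega), if_pos (by omega)]
        · rw [if_pos rfl, if_pos (by omega)]
        · rw [if_neg (by omega), if_neg (by omega), if_neg (by omega)]
  obtain ⟨t', h1, h2⟩ := key ℓ le_rfl
  have hl : 0 < ℓ := Nat.pos_of_ne_zero (NeZero.ne ℓ)
  rw [rotF, Function.iterate_succ_apply', h1, Function.comp_apply, gateF_xg hμ, mstep_of_mem hμ]
  have h0 := h2 0 hl
  simp only [Nat.cast_zero, mul_zero, add_zero, if_pos hl] at h0
  simp only [ZMod.natCast_self, mul_zero, add_zero, tri_mix, mix_mix, h0]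
  rw [show v 0 = tri r.2 from rfl, mix_tri]
  congr 1
  refine tape_ext p hs fun j hj => ?_
  rw [show Function.update t' p (v ℓ) = Function.update t' (p + sd a * (0 : ℕ)) (v ℓ) by simp,
    update_off p hs hj hl, h2 j hj, if_pos hj]
  split_ifs with h
  · subst h
    simp only [v, hl.ne', if_false, Nat.cast_sub (show 1 ≤ ℓ from hl), ZMod.natCast_self]
    congr 1
    push_cast
    ring
  · simp only [v, h, if_false, Nat.cast_sub (show 1 ≤ j by omega)]
    congr 1
    push_cast
    ring

/-- The type of an arrow: `1` if filled, `2` if hollow. -/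
def ty : Arrow → Letter
  | .rf => 1
  | .lf => 1
  | .rh => 2
  | .lh => 2

/-- The arrow of the opposite side with the same type. -/
def fl : Arrow → Arrow
  | .rf => .lf
  | .lf => .rf
  | .rh => .lh
  | .lh => .rh

/-- The arrow of the same side with type `b`. -/
def wt (a : Arrow) (b : Letter) : Arrow :=
  match a with
  | .rf => if b = 2 then .lh else .rf
  | .lf => if b = 2 then .rh else .lf
  | .rh => if b = 2 then .rh else .lf
  | .lh => if b = 2 then .lh else .rf

theorem sd_fl (a : Arrow) : sd (fl a) = -sd a := by revert a; decide
theorem sd_wt (a : Arrow) (b : Letter) : sd (wt a b) = sd a := by revert a b; decide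
theorem ty_wt (a : Arrow) (b : Letter) (hb : b ≠ 0) : ty (wt a b) = b := by revert a b; decide
theorem wt_ty (a : Arrow) : wt a (ty a) = a := by revert a; decide
theorem wt_wt (a : Arrow) (b c : Letter) : wt (wt a b) c = wt a c := by revert a b c; decide
theorem fl_fl (a : Arrow) : fl (fl a) = a := by revert a; decide
theorem fl_wt (a : Arrow) (b : Letter) : fl (wt a b) = wt (fl a) b := by revert a b; decide
theorem ty_ne_zero (a : Arrow) : ty a ≠ 0 := by revert a; decide
theorem ty_eq (a : Arrow) : ty a = 1 ∨ ty a = 2 := by revert a; decide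

/-- Toggle the duck if the letter is nonzero. -/
def hToggle (u : Arrow × Fin 2 × Letter) : Arrow × Fin 2 × Letter :=
  (u.1, if u.2.2 = 0 then u.2.1 else u.2.1 + 1, u.2.2)

/-- Exchange type and letter. -/
def hType (u : Arrow × Fin 2 × Letter) : Arrow × Fin 2 × Letter :=
  if u.2.1 = 1 ∧ u.2.2 ≠ 0 then (wt u.1 u.2.2, u.2.1, ty u.1) else u

/-- Exchange the letters `0` and `1`. -/
def hSwap (u : Arrow × Fin 2 × Letter) : Arrow × Fin 2 × Letter :=
  (u.1, u.2.1, Equiv.swap 0 1 u.2.2)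

/-- Flip the side of states with duck `d`. -/
def hFlip (d : Fin 2) (u : Arrow × Fin 2 × Letter) : Arrow × Fin 2 × Letter :=
  (if u.2.1 = d then fl u.1 else u.1, u.2.1, u.2.2)

theorem hToggle_bijective : Function.Bijective hToggle :=
  Function.Involutive.bijective (by unfold Function.Involutive; decide +kernel)

theorem hType_bijective : Function.Bijective hType :=
  Function.Involutive.bijective (by unfold Function.Involutive; decide +kernel)

theorem hSwap_bijective : Function.Bijective hSwap :=
  Function.Involutive.bijective (by unfold Function.Involutive; decide +kernel)

theorem hFlip_bijective (d : Fin 2) : Function.Bijective (hFlip d) :=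
  Function.Involutive.bijective (by unfold Function.Involutive; revert d; decide +kernel)

theorem sd_hType (u : Arrow × Fin 2 × Letter) : sd (hType u).1 = sd u.1 := by
  unfold hType
  split_ifs <;> simp [sd_wt]

/-- Half of `3 ^ k - 1`. -/
def gk (k : ℕ) : ℕ := (3 ^ k - 1) / 2

theorem two_mul_gk (k : ℕ) : 2 * gk k + 1 = 3 ^ k := by
  have h : 3 ^ k % 2 = 1 := by simp [Nat.pow_mod]
  unfold gk
  generalize 3 ^ k = m at h ⊢
  omega

/-- Append the digit at distance `k`, in duck state `0`. -/
noncomputable def tailF {ℓ : ℕ} (k : ℕ) : HC ℓ → HC ℓ :=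
  ccellF k (-1) (carryList (3 ^ k - 1) k) hSwap ∘ cellF k (lg hSwap) ∘
    cellF k (lg (addH (fun _ _ => true) 1))

/-- Go to the other end of the window of size `k + 1` and reverse it, for duck `1`. -/
noncomputable def turnF {ℓ : ℕ} (k : ℕ) : HC ℓ → HC ℓ :=
  revF (fun _ d => d == 1) k ∘ gateF (lg (hFlip 1)) ∘
    shiftF (fun q => if q.2.1 = 1 then sd q.1.1 * k else 0)

/-- Pass from codes with `k` digits to codes with `k + 1` digits. -/
noncomputable def stepF {ℓ : ℕ} (k : ℕ) : HC ℓ → HC ℓ :=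
  tailF k ∘ cellF k (lg hToggle) ∘ turnF k ∘ cellF k (lg hType) ∘
    addF (fun a d => d == 1 && ty a == 2) (gk k + 1) k ∘
    addF (fun a d => d == 1 && ty a == 1) (gk k) k ∘ cellF k (lg hToggle)

theorem FC.tail {ℓ : ℕ} (h2 : 2 ≤ ℓ) {k : ℕ} (hk : k < ℓ) :
    FC (ℓ := ℓ) (tailF k) ((cc + 386) * ℓ ^ 2) := by
  refine ((FC.ccell hSwap_bijective (fun _ => rfl) hk.le h2 rfl (disjoint_carryList _ k)
    (by rwa [length_carryList])).comp ((FC.lcell hSwap_bijective (fun _ => rfl) hk.le (by omega)).comp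
    (FC.lcell (addH_bijective _ _) (fun _ => rfl) hk.le (by omega)))).mono ?_
  nlinarith

theorem FC.turn {ℓ : ℕ} (h2 : 2 ≤ ℓ) {k : ℕ} (hk : k < ℓ) :
    FC (ℓ := ℓ) (turnF k) (676 * ℓ ^ 2) := by
  refine ((FC.rev (by omega) _ hk).comp ((FC.lg (hFlip_bijective 1)).comp
    (FC.shift _ ℓ fun q => ?_))).mono ?_
  · split_ifs
    · rw [Int.natAbs_mul, sd_natAbs, Int.natAbs_natCast]
      omega
    · simp
  · nlinarith

theorem FC.step {ℓ : ℕ} (h2 : 2 ≤ ℓ) {k : ℕ} (hk : k < ℓ) :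
    FC (ℓ := ℓ) (stepF k) ((3 * cc + 2200) * ℓ ^ 3) := by
  refine ((FC.tail h2 hk).comp ((FC.lcell hToggle_bijective (fun _ => rfl) hk.le (by omega)).comp
    ((FC.turn h2 hk).comp ((FC.lcell hType_bijective sd_hType hk.le (by omega)).comp
    ((FC.add h2 _ _ hk.le).comp ((FC.add h2 _ _ hk.le).comp
    (FC.lcell hToggle_bijective (fun _ => rfl) hk.le (by omega)))))))).mono ?_
  have h3 : k * ((cc + 193) * ℓ ^ 2) ≤ ℓ * ((cc + 193) * ℓ ^ 2) := Nat.mul_le_mul_right _ hk.le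
  have h4 : ℓ ≤ ℓ ^ 2 := Nat.le_self_pow (by norm_num) ℓ
  have h5 : 2 * ℓ ^ 2 ≤ ℓ ^ 3 := by rw [pow_succ ℓ 2, mul_comm]; exact Nat.mul_le_mul_left _ h2
  have h6 : cc * (2 * ℓ ^ 2) ≤ cc * ℓ ^ 3 := Nat.mul_le_mul_left _ h5
  have h7 : ℓ * ((cc + 193) * ℓ ^ 2) = cc * ℓ ^ 3 + 193 * ℓ ^ 3 := by ring
  have h8 : (3 * cc + 2200) * ℓ ^ 3 = 3 * (cc * ℓ ^ 3) + 2200 * ℓ ^ 3 := by ring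
  have h9 : (cc + 386) * ℓ ^ 2 = cc * ℓ ^ 2 + 386 * ℓ ^ 2 := by ring
  have h10 : cc * (2 * ℓ ^ 2) = 2 * (cc * ℓ ^ 2) := by ring
  omega

theorem dg_add_mul {M k c : ℕ} (hM : M < 3 ^ k) (hc : c < 3) : dg (M + c * 3 ^ k) k = ⟨c, hc⟩ := by
  apply Fin.ext
  simp only [dg]
  rw [Nat.add_mul_div_right _ _ (by positivity), Nat.div_eq_of_lt hM, zero_add,
    Nat.mod_eq_of_lt hc]

theorem wr_succ_eq {ℓ : ℕ} [NeZero ℓ] (p : ZMod ℓ) {s : ℤ} (hs : s = 1 ∨ s = -1) {k : ℕ}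
    (hk : k < ℓ) {M : ℕ} (hM : M < 3 ^ k) (c : Letter) (t : ZMod ℓ → Letter) :
    wr p s (k + 1) (M + c.val * 3 ^ k) t = wr p s k M (Function.update t (p + s * k) c) := by
  rw [wr_succ p hs hk, dg_add_mul hM c.isLt]
  exact wr_congr p k (by simp) _

theorem tailF_cf {ℓ : ℕ} [NeZero ℓ] {k : ℕ} (hk : k < ℓ) (p : ZMod ℓ) (a : Arrow)
    (d : Fin 2) (r : Fin 2 × Fin 6) {N : ℕ} (hN : N < 3 ^ k) (t : ZMod ℓ → Letter) (c l : Letter)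
    (hc : c = if N = 0 then Equiv.swap 0 1 (l + 1) else l + 1) :
    tailF k (cf p a d r (wr p (sd a) k N (Function.update t (p + sd a * k) l))) =
      cf p a d r (wr p (sd a) (k + 1) (N + c.val * 3 ^ k) t) := by
  have hs := sd_eq a
  rw [wr_succ_eq p hs hk hN, tailF, Function.comp_apply, Function.comp_apply, cellF_cf, cellF_cf]
  simp only [addH, hSwap, if_true]
  rw [wr_apply p hs hk, if_neg (lt_irrefl k), Function.update_self, Function.update_self,
    Function.update_idem, update_wr p hs le_rfl hk, Function.update_idem, ccellF_cf]
  have hscan := scanW_carryList p hs (3 ^ k - 1) N (le_refl k) hk.le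
    (Function.update t (p + sd a * k) (Equiv.swap 0 1 (l + 1)))
  rw [Nat.mod_eq_of_lt hN, Nat.mod_eq_of_lt (by omega : 3 ^ k - 1 < 3 ^ k)] at hscan
  by_cases h : N = 0
  · rw [if_neg (fun hh => by have := hscan.1 hh; omega), hc, if_pos h]
  · rw [if_pos (hscan.2 (by omega)), hc, if_neg h, cellF_cf]
    simp only [hSwap]
    rw [wr_apply p hs hk, if_neg (lt_irrefl k), Function.update_self,
      update_wr p hs le_rfl hk, Function.update_idem, Equiv.swap_apply_self]

theorem turnF_zero {ℓ : ℕ} (k : ℕ) (p : ZMod ℓ) (a : Arrow) (r : Fin 2 × Fin 6)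
    (t : ZMod ℓ → Letter) : turnF k (cf p a 0 r t) = cf p a 0 r t := by
  rw [turnF, Function.comp_apply, Function.comp_apply,
    show shiftF _ (cf p a 0 r t) = cf p a 0 r t by simp [shiftF, cf],
    show gateF _ (cf p a 0 r t) = cf p a 0 r t by simp [gateF, cf, lg, hFlip], revF_of_notMem rfl]

theorem turnF_one {ℓ : ℕ} [NeZero ℓ] {k : ℕ} (hk : k < ℓ) (p : ZMod ℓ) (a : Arrow)
    (r : Fin 2 × Fin 6) (N : ℕ) (t : ZMod ℓ → Letter) (y : Letter) :
    turnF k (cf p a 1 r (wr p (sd a) k N (Function.update t (p + sd a * k) y))) =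
      cf (p + (sd a : ZMod ℓ) * (k : ZMod ℓ)) (fl a) 1 r
        (wr (p + (sd a : ZMod ℓ) * (k : ZMod ℓ)) (sd (fl a)) k N (Function.update t p y)) := by
  have hs := sd_eq a
  have hs' := sd_eq (fl a)
  rw [turnF, Function.comp_apply, Function.comp_apply,
    show shiftF _ (cf p a 1 r _) = cf (p + (sd a : ZMod ℓ) * (k : ZMod ℓ)) a 1 r _ by
      simp [shiftF, cf]; rfl,
    show gateF _ (cf (p + (sd a : ZMod ℓ) * (k : ZMod ℓ)) a 1 r _) =
      cf (p + (sd a : ZMod ℓ) * (k : ZMod ℓ)) (fl a) 1 r _ by simp [gateF, cf, lg, hFlip]; rfl]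
  refine revF_of_mem rfl hk r _ _ fun j hj => ?_
  have hp : p = p + (sd a : ZMod ℓ) * (k : ZMod ℓ) + (sd (fl a) : ZMod ℓ) * (k : ZMod ℓ) := by
    rw [sd_fl]; push_cast; ring
  rw [wr_apply _ hs' hj]
  have e1 : Function.update t p y (p + (sd a : ZMod ℓ) * (k : ZMod ℓ) + sd (fl a) * j) =
      if j = k then y else t (p + (sd a : ZMod ℓ) * (k : ZMod ℓ) + sd (fl a) * j) := by
    conv_lhs => rw [show Function.update t p y = Function.update t (p + (sd a : ZMod ℓ) *
      (k : ZMod ℓ) + (sd (fl a) : ZMod ℓ) * (k : ZMod ℓ)) y by rw [← hp]]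
    rw [update_off _ hs' hj hk]
  rw [e1]
  by_cases h : j ≤ k
  · rw [if_pos h, show p + (sd a : ZMod ℓ) * (k : ZMod ℓ) + sd (fl a) * ((k - j : ℕ) : ZMod ℓ) =
      p + sd a * j by rw [sd_fl, Nat.cast_sub h]; push_cast; ring, wr_apply p hs hj,
      update_off p hs hj hk]
    by_cases h' : j = k
    · rw [if_neg (by omega), if_pos h']
      simp [h']
    · rw [if_pos (by omega), if_pos (by omega)]
  · rw [if_neg (by omega), if_neg (by omega), if_neg h]
    have e2 : p + (sd a : ZMod ℓ) * (k : ZMod ℓ) + sd (fl a) * (j : ZMod ℓ) =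
        p + sd a * ((ℓ + k - j : ℕ) : ZMod ℓ) := by
      rw [sd_fl, Nat.cast_sub (by omega), Nat.cast_add, ZMod.natCast_self]; push_cast; ring
    rw [e2, wr_apply p hs (by omega), if_neg (by omega), update_off p hs (by omega) hk,
      if_neg (by omega)]

theorem stepF_zero {ℓ : ℕ} [NeZero ℓ] {k : ℕ} (hk : k < ℓ) (p : ZMod ℓ) (a : Arrow)
    (r : Fin 2 × Fin 6) {N : ℕ} (hN : N < 3 ^ k) (t : ZMod ℓ → Letter)
    (ht : t (p + sd a * k) = 0) :
    stepF k (cf p a 0 r (wr p (sd a) k N t)) =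
      cf p a 0 r (wr p (sd a) (k + 1) (if N = 0 then 0 else N + 3 ^ k) t) := by
  have hs := sd_eq a
  have ht' : t = Function.update t (p + sd a * k) 0 := by rw [← ht, Function.update_eq_self]
  have e0 : wr p (sd a) k N t (p + sd a * k) = 0 := by rw [wr_apply p hs hk, if_neg (by simp), ht]
  have e1 : Function.update (wr p (sd a) k N t) (p + sd a * k) 0 = wr p (sd a) k N t := by
    rw [← e0, Function.update_eq_self]
  have e2 : cellF k (lg hToggle) (cf p a 0 r (wr p (sd a) k N t)) =
      cf p a 0 r (wr p (sd a) k N t) := by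
    rw [cellF_cf]
    simp [hToggle, e0, e1]
  have e3 : cellF k (lg hType) (cf p a 0 r (wr p (sd a) k N t)) =
      cf p a 0 r (wr p (sd a) k N t) := by
    rw [cellF_cf]
    simp [hType, e0, e1]
  simp only [stepF, Function.comp_apply]
  rw [e2, addF_of_notMem _ _ _ _ rfl, addF_of_notMem _ _ _ _ rfl, e3, turnF_zero, e2]
  conv_lhs => rw [ht']
  rw [tailF_cf hk p a 0 r hN t (if N = 0 then 0 else 1) 0 (by split_ifs <;> simp)]
  split_ifs with h <;> simp [h]

/-- The code obtained when the digit at distance `k` of a code is nonzero. -/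
def turnCode (k N : ℕ) (y : Letter) : ℕ :=
  if y = 1 then (N + gk k) % 3 ^ k + 2 * 3 ^ k
  else if (N + (gk k + 1)) % 3 ^ k = 0 then 3 ^ k else (N + (gk k + 1)) % 3 ^ k

theorem stepF_ne {ℓ : ℕ} [NeZero ℓ] {k : ℕ} (hk : k < ℓ) (p : ZMod ℓ) (a : Arrow)
    (r : Fin 2 × Fin 6) (N : ℕ) (t : ZMod ℓ → Letter)
    (ht : t (p + sd a * k) ≠ 0) :
    stepF k (cf p a 0 r (wr p (sd a) k N t)) =
      cf (p + (sd a : ZMod ℓ) * (k : ZMod ℓ)) (wt (fl a) (t (p + sd a * k))) 0 r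
        (wr (p + (sd a : ZMod ℓ) * (k : ZMod ℓ)) (-sd a) (k + 1) (turnCode k N (ty a)) t) := by
  have hs := sd_eq a
  have e0 : ∀ M, wr p (sd a) k M t (p + sd a * k) = t (p + sd a * k) := fun M => by
    rw [wr_apply p hs hk, if_neg (by simp)]
  have e2 : cellF k (lg hToggle) (cf p a 0 r (wr p (sd a) k N t)) =
      cf p a 1 r (wr p (sd a) k N t) := by
    rw [cellF_cf]
    simp only [hToggle, e0, ht, if_false, zero_add]
    congr 1
    exact (congrArg _ (e0 N).symm).trans (Function.update_eq_self _ _)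
  obtain ⟨M, hM, hadd, htail⟩ : ∃ M < 3 ^ k,
      addF (fun a d => d == 1 && ty a == 2) (gk k + 1) k
        (addF (fun a d => d == 1 && ty a == 1) (gk k) k (cf p a 1 r (wr p (sd a) k N t))) =
      cf p a 1 r (wr p (sd a) k M t) ∧ turnCode k N (ty a) =
      M + (if M = 0 then Equiv.swap 0 1 (ty a + 1) else ty a + 1 : Letter).val * 3 ^ k := by
    have hpos : 0 < 3 ^ k := by positivity
    rcases ty_eq a with h | h
    · refine ⟨(N + gk k) % 3 ^ k, Nat.mod_lt _ hpos, ?_, ?_⟩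
      · rw [addF_of_mem _ _ _ hk.le p (by simp [h]), addF_of_notMem _ _ _ _ (by simp [h])]
        rw [wr_congr p k (Nat.mod_mod _ _).symm]
      · rw [h, turnCode, if_pos rfl]
        have : ∀ c : Prop, ∀ [Decidable c],
            (if c then Equiv.swap 0 1 ((1 : Letter) + 1) else 1 + 1 : Letter) = 2 := by
          intro c _; split_ifs <;> decide
        rw [this]
        rfl
    · refine ⟨(N + (gk k + 1)) % 3 ^ k, Nat.mod_lt _ hpos, ?_, ?_⟩
      · rw [addF_of_notMem _ _ _ _ (by simp [h]), addF_of_mem _ _ _ hk.le p (by simp [h])]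
        rw [wr_congr p k (Nat.mod_mod _ _).symm]
      · rw [h, turnCode, if_neg (by decide)]
        split_ifs with h0
        · rw [h0, show (Equiv.swap 0 1 ((2 : Letter) + 1) : Letter) = 1 by decide]
          simp
        · rw [show ((2 : Letter) + 1 : Letter) = 0 by decide]
          simp
  have hs' := sd_eq (wt (fl a) (t (p + sd a * k)))
  have hsd : sd (wt (fl a) (t (p + sd a * k))) = -sd a := by rw [sd_wt, sd_fl]
  have hp : p = p + (sd a : ZMod ℓ) * (k : ZMod ℓ) +
      (sd (wt (fl a) (t (p + sd a * k))) : ZMod ℓ) * (k : ZMod ℓ) := by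
    rw [hsd]; push_cast; ring
  have e3 : cellF k (lg hType) (cf p a 1 r (wr p (sd a) k M t)) =
      cf p (wt a (t (p + sd a * k))) 1 r
        (wr p (sd (wt a (t (p + sd a * k)))) k M (Function.update t (p + sd (wt a
          (t (p + sd a * k))) * k) (ty a))) := by
    rw [cellF_cf, sd_wt]
    simp only [hType, e0, ht, ne_eq, not_false_eq_true, and_self, if_true]
    rw [update_wr p hs le_rfl hk]
  simp only [stepF, Function.comp_apply]
  rw [e2, hadd, e3, turnF_one hk, fl_wt]
  simp only [sd_wt a]
  generalize hb : t (p + sd a * k) = b at *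
  have e4 : cellF k (lg hToggle) (cf (p + (sd a : ZMod ℓ) * (k : ZMod ℓ)) (wt (fl a) b) 1 r
      (wr (p + (sd a : ZMod ℓ) * (k : ZMod ℓ)) (sd (wt (fl a) b)) k M
        (Function.update t p (ty a)))) =
      cf (p + (sd a : ZMod ℓ) * (k : ZMod ℓ)) (wt (fl a) b) 0 r
      (wr (p + (sd a : ZMod ℓ) * (k : ZMod ℓ)) (sd (wt (fl a) b)) k M
        (Function.update t p (ty a))) := by
    rw [cellF_cf, ← hp]
    have : (wr (p + (sd a : ZMod ℓ) * (k : ZMod ℓ)) (sd (wt (fl a) b)) k M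
        (Function.update t p (ty a))) p = ty a := by
      have h := wr_apply (p + (sd a : ZMod ℓ) * (k : ZMod ℓ)) hs' hk k M
        (Function.update t p (ty a))
      rwa [← hp, if_neg (by simp), Function.update_self] at h
    simp only [hToggle, this, ty_ne_zero, if_false]
    congr 1
    exact (congrArg _ this.symm).trans (Function.update_eq_self _ _)
  rw [e4]
  conv_lhs => rw [show Function.update t p (ty a) = Function.update t (p +
    (sd a : ZMod ℓ) * (k : ZMod ℓ) + (sd (wt (fl a) b) : ZMod ℓ) * (k : ZMod ℓ)) (ty a)
    by rw [← hp]]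
  rw [tailF_cf hk _ _ 0 r hM t _ _ rfl, htail, hsd]

theorem scanW_replicate_or {ℓ : ℕ} (δ : ℤ) (n : ℕ) (p : ZMod ℓ) (t : ZMod ℓ → Letter) :
    scanW δ (List.replicate n ({0}, {0}ᶜ)) p t ↔ ∃ i < n, t (p + (δ : ZMod ℓ) * (i : ZMod ℓ)) ≠ 0 := by
  induction n generalizing p with
  | zero => simp [scanW]
  | succ n ih =>
    rw [List.replicate_succ, scanW, ih]
    have e : ∀ i : ℕ, p + (δ : ZMod ℓ) + (δ : ZMod ℓ) * (i : ZMod ℓ) =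
        p + (δ : ZMod ℓ) * ((i + 1 : ℕ) : ZMod ℓ) := fun i => by push_cast; ring
    simp only [e, Set.mem_compl_iff, Set.mem_singleton_iff]
    constructor
    · rintro (h | ⟨_, i, hi, h⟩)
      · exact ⟨0, by omega, by simpa using h⟩
      · exact ⟨i + 1, by omega, h⟩
    · rintro ⟨i, hi, h⟩
      by_cases h0 : t p = 0
      · rcases i with _ | i
        · simp [h0] at h
        · exact Or.inr ⟨h0, i, by omega, h⟩
      · exact Or.inl h0

theorem scanW_replicate_and {ℓ : ℕ} (δ : ℤ) (n : ℕ) (p : ZMod ℓ) (t : ZMod ℓ → Letter) :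
    scanW δ (List.replicate n ({0}, ∅) ++ [(∅, {0}ᶜ)]) p t ↔
      (∀ i < n, t (p + (δ : ZMod ℓ) * (i : ZMod ℓ)) = 0) ∧
        t (p + (δ : ZMod ℓ) * (n : ZMod ℓ)) ≠ 0 := by
  induction n generalizing p with
  | zero => simp [scanW]
  | succ n ih =>
    rw [List.replicate_succ, List.cons_append, scanW, ih]
    have e : ∀ i : ℕ, p + (δ : ZMod ℓ) + (δ : ZMod ℓ) * (i : ZMod ℓ) =
        p + (δ : ZMod ℓ) * ((i + 1 : ℕ) : ZMod ℓ) := fun i => by push_cast; ring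
    simp only [e, Set.mem_empty_iff_false, false_or, Set.mem_singleton_iff]
    rw [← and_assoc]
    refine and_congr_left fun _ => ⟨fun h i hi => ?_, fun h => ⟨by simpa using h 0 (by omega),
      fun i hi => h (i + 1) (by omega)⟩⟩
    rcases i with _ | i
    · simpa using h.1
    · exact h.2 i (by omega)

/-- The gate that undoes one turn. -/
def hTurn (u : Arrow × Fin 2 × Letter) : Arrow × Fin 2 × Letter :=
  if u.2.1 = 0 then
    if u.2.2 = 0 then (wt (fl u.1) 1, 0, ty u.1)
    else if ty u.1 = 1 then (u.1, 1, u.2.2) else u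
  else if ty u.1 = 1 ∧ u.2.2 ≠ 0 then (wt (fl u.1) u.2.2, 0, 0) else u

/-- Exchange filled turning states with start states. -/
def hStart (u : Arrow × Fin 2 × Letter) : Arrow × Fin 2 × Letter :=
  if u.2.1 = 0 then
    if u.2.2 = 0 then (wt u.1 1, 1, ty u.1) else u
  else if ty u.1 = 1 ∧ u.2.2 ≠ 0 then (wt u.1 u.2.2, 0, 0) else u

theorem hTurn_bijective : Function.Bijective hTurn := by
  have h : ∀ u, hTurn (hTurn (hTurn u)) = u := by decide +kernel
  exact ⟨fun u v huv => by rw [← h u, huv, h], fun u => ⟨_, h u⟩⟩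

theorem hStart_hStart (u : Arrow × Fin 2 × Letter) : hStart (hStart u) = u := by
  revert u; decide +kernel

theorem hStart_bijective : Function.Bijective hStart :=
  Function.Involutive.bijective hStart_hStart

theorem sd_hStart (u : Arrow × Fin 2 × Letter) : sd (hStart u).1 = sd u.1 := by
  unfold hStart
  split_ifs <;> simp [sd_wt]

/-- The start gate, if the nearest nonzero letter behind the head is at distance `k`, or if
`k = ℓ` and there is none. -/
noncomputable def startF {ℓ : ℕ} (k : ℕ) : HC ℓ → HC ℓ :=
  if k < ℓ then ccellF 0 (-1) (List.replicate (k - 1) ({0}, ∅) ++ [(∅, {0}ᶜ)]) hStart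
  else ccellF 0 (-1) (List.replicate (k - 1) ({0}, {0}ᶜ)) hStart ∘ cellF 0 (lg hStart)

/-- Bring the turning configurations at distance `k` back to the start. -/
noncomputable def backF {ℓ : ℕ} (k : ℕ) : HC ℓ → HC ℓ :=
  shiftF (fun q => -(if q.2.1 = 1 then sd q.1.1 * k else 0)) ∘ gateF (lg (hFlip 0)) ∘ startF k ∘
    gateF (lg (hFlip 0)) ∘ shiftF (fun q => if q.2.1 = 1 then sd q.1.1 * k else 0)

theorem FC.start {ℓ : ℕ} (h2 : 2 ≤ ℓ) {k : ℕ} (hk : k ≤ ℓ) (hk0 : 1 ≤ k) :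
    FC (ℓ := ℓ) (startF k) ((cc + 193) * ℓ ^ 2) := by
  unfold startF
  split_ifs with h
  · refine (FC.ccell hStart_bijective sd_hStart (by omega) h2 rfl ?_ ?_).mono (by nlinarith)
    · intro e he
      simp only [List.mem_append, List.mem_replicate, List.mem_singleton] at he
      rcases he with ⟨_, rfl⟩ | rfl <;> simp
    · simp; omega
  · refine ((FC.ccell hStart_bijective sd_hStart (by omega) h2 rfl ?_ ?_).comp
      (FC.lcell hStart_bijective sd_hStart (by omega) (by omega))).mono (by nlinarith)
    · intro e he
      rw [List.mem_replicate] at he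
      rw [he.2]
      exact disjoint_compl_right
    · simp; omega

theorem FC.back {ℓ : ℕ} (h2 : 2 ≤ ℓ) {k : ℕ} (hk : k ≤ ℓ) (hk0 : 1 ≤ k) :
    FC (ℓ := ℓ) (backF k) ((cc + 387) * ℓ ^ 2) := by
  have h : FC (ℓ := ℓ) (shiftF (fun q => if q.2.1 = 1 then sd q.1.1 * k else 0)) (96 * ℓ) :=
    FC.shift _ ℓ fun q => by
      split_ifs
      · rw [Int.natAbs_mul, sd_natAbs, Int.natAbs_natCast]
        omega
      · simp
  refine ((h.inv fun x => shiftF_inv _ x).comp ((FC.lg (hFlip_bijective 0)).comp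
    ((FC.start h2 hk hk0).comp ((FC.lg (hFlip_bijective 0)).comp h)))).mono ?_
  nlinarith

theorem backF_zero {ℓ : ℕ} (k : ℕ) (p : ZMod ℓ) (a : Arrow) (r : Fin 2 × Fin 6)
    (t : ZMod ℓ → Letter) (h : startF k (cf p (fl a) 0 r t) = cf p (fl a) 0 r t) :
    backF k (cf p a 0 r t) = cf p a 0 r t := by
  simp only [backF, Function.comp_apply]
  rw [show shiftF _ (cf p a 0 r t) = cf p a 0 r t by simp [shiftF, cf],
    show gateF _ (cf p a 0 r t) = cf p (fl a) 0 r t by simp [gateF, cf, lg, hFlip], h,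
    show gateF _ (cf p (fl a) 0 r t) = cf p a 0 r t by simp [gateF, cf, lg, hFlip, fl_fl]]
  simp [shiftF, cf]

theorem shiftF_one {ℓ : ℕ} (k : ℕ) (p : ZMod ℓ) (a : Arrow) (r : Fin 2 × Fin 6)
    (t : ZMod ℓ → Letter) : gateF (lg (hFlip 0)) (shiftF
      (fun q => if q.2.1 = 1 then sd q.1.1 * k else 0) (cf p a 1 r t)) =
      cf (p + (sd a : ZMod ℓ) * (k : ZMod ℓ)) a 1 r t := by
  rw [show shiftF _ (cf p a 1 r t) = cf (p + (sd a : ZMod ℓ) * (k : ZMod ℓ)) a 1 r t by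
    simp [shiftF, cf]]
  simp [gateF, cf, lg, hFlip]

/-- `startF` is trivial where the start gate is. -/
theorem startF_of_fixed {ℓ : ℕ} (k : ℕ) (p : ZMod ℓ) (a : Arrow) (d : Fin 2) (r : Fin 2 × Fin 6)
    (t : ZMod ℓ → Letter) (h : hStart (a, d, t p) = (a, d, t p)) :
    startF k (cf p a d r t) = cf p a d r t := by
  have e : cellF 0 (lg hStart) (cf p a d r t) = cf p a d r t := by
    rw [cellF_cf]
    simp [h]
  unfold startF
  split_ifs
  · rw [ccellF_cf, e, ite_self]
  · rw [Function.comp_apply, e, ccellF_cf, e, ite_self]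

theorem backF_zero_of_ne {ℓ : ℕ} (k : ℕ) (p : ZMod ℓ) (a : Arrow) (r : Fin 2 × Fin 6)
    (t : ZMod ℓ → Letter) (h : t p ≠ 0) : backF k (cf p a 0 r t) = cf p a 0 r t :=
  backF_zero k p a r t (startF_of_fixed k p _ 0 r t (by simp [hStart, h]))

theorem backF_one_of_eq {ℓ : ℕ} (k : ℕ) (p : ZMod ℓ) (a : Arrow) (r : Fin 2 × Fin 6)
    (t : ZMod ℓ → Letter) (h : t (p + sd a * k) = 0) :
    backF k (cf p a 1 r t) = cf p a 1 r t := by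
  simp only [backF, Function.comp_apply]
  rw [shiftF_one, startF_of_fixed k _ _ 1 r t (by simp [hStart, h])]
  simp [shiftF, cf, gateF, lg, hFlip]

/-- The letters behind the head, as seen by `startF`. -/
theorem scan_offset {ℓ : ℕ} (p : ZMod ℓ) (s : ℤ) (i : ℕ) :
    p + (s : ZMod ℓ) * ((0 : ℕ) : ZMod ℓ) + ((-1 * s : ℤ) : ZMod ℓ) +
      ((-1 * s : ℤ) : ZMod ℓ) * (i : ZMod ℓ) = p - (s : ZMod ℓ) * ((i + 1 : ℕ) : ZMod ℓ) := by
  push_cast; ring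

theorem sub_mul_ne {ℓ : ℕ} (p : ZMod ℓ) {s : ℤ} (hs : s = 1 ∨ s = -1) {i : ℕ} (hi : i < ℓ)
    (h0 : 1 ≤ i) : p - (s : ZMod ℓ) * (i : ZMod ℓ) ≠ p := by
  intro h
  have := (add_mul_inj p hs (i := 0) (j := i) (by omega) hi).1 (by
    rw [Nat.cast_zero, mul_zero, add_zero]; linear_combination h)
  omega

/-- Nothing happens if there is a nonzero letter strictly closer than `k`. -/
theorem startF_of_ne {ℓ : ℕ} {k m : ℕ} (hk : k ≤ ℓ) (hm0 : 1 ≤ m) (hm : m < k) (p : ZMod ℓ)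
    (a : Arrow) (d : Fin 2) (r : Fin 2 × Fin 6) (t : ZMod ℓ → Letter)
    (h : t (p - sd a * m) ≠ 0) : startF k (cf p a d r t) = cf p a d r t := by
  have hs := sd_eq a
  unfold startF
  split_ifs with hkl
  · rw [ccellF_cf, if_neg]
    rw [scanW_replicate_and]
    simp only [scan_offset]
    rintro ⟨h1, _⟩
    exact h (by simpa [Nat.sub_add_cancel hm0] using h1 (m - 1) (by omega))
  · rw [Function.comp_apply, cellF_cf, ccellF_cf, if_pos, cellF_cf]
    · generalize hu : (a, d, t (p + sd a * ((0 : ℕ) : ZMod ℓ))) = u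
      have hsd : sd (hStart u).1 = sd a := by rw [sd_hStart, ← hu]
      simp only [hsd, Function.update_self, Function.update_idem]
      rw [show ((hStart u).1, (hStart u).2.1, (hStart u).2.2) = hStart u from rfl, hStart_hStart,
        ← hu, Function.update_eq_self]
    · rw [sd_hStart, scanW_replicate_or]
      refine ⟨m - 1, by omega, ?_⟩
      rw [scan_offset, Nat.sub_add_cancel hm0, Function.update_of_ne]
      · exact h
      · rw [Nat.cast_zero, mul_zero, add_zero]
        exact sub_mul_ne p hs (by omega) hm0

theorem startF_of_eq {ℓ : ℕ} {k : ℕ} (hk0 : 1 ≤ k) (hk : k ≤ ℓ) (p : ZMod ℓ)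
    (a : Arrow) (d : Fin 2) (r : Fin 2 × Fin 6) (t : ZMod ℓ → Letter)
    (h : ∀ i, 1 ≤ i → i < k → t (p - sd a * i) = 0) (h' : k < ℓ → t (p - sd a * k) ≠ 0) :
    startF k (cf p a d r t) = cellF 0 (lg hStart) (cf p a d r t) := by
  have hs := sd_eq a
  unfold startF
  split_ifs with hkl
  · rw [ccellF_cf, if_pos]
    rw [scanW_replicate_and]
    simp only [scan_offset]
    exact ⟨fun i hi => h (i + 1) (by omega) (by omega), by
      rw [Nat.sub_add_cancel hk0]; exact h' hkl⟩
  · rw [Function.comp_apply, cellF_cf, ccellF_cf, if_neg]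
    rw [sd_hStart, scanW_replicate_or]
    rintro ⟨i, hi, h1⟩
    refine h1 ?_
    rw [scan_offset, Function.update_of_ne]
    · exact h (i + 1) (by omega) (by omega)
    · rw [Nat.cast_zero, mul_zero, add_zero]
      exact sub_mul_ne p hs (by omega) (by omega)

theorem backF_zero_of_lt {ℓ : ℕ} {k m : ℕ} (hk : k ≤ ℓ) (hm0 : 1 ≤ m) (hm : m < k) (p : ZMod ℓ)
    (a : Arrow) (r : Fin 2 × Fin 6) (t : ZMod ℓ → Letter)
    (h : t (p + sd a * m) ≠ 0) : backF k (cf p a 0 r t) = cf p a 0 r t := by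
  refine backF_zero k p a r t (startF_of_ne hk hm0 hm p _ 0 r t ?_)
  rw [sd_fl]
  simpa using h

/-- Unwinding of turning configurations. -/
noncomputable def unturnF {ℓ : ℕ} : ℕ → HC ℓ → HC ℓ
  | 0 => gateF (lg hTurn)
  | k + 1 => backF (k + 1) ∘ unturnF k

theorem FC.unturn {ℓ : ℕ} (h2 : 2 ≤ ℓ) {k : ℕ} (hk : k ≤ ℓ) :
    FC (ℓ := ℓ) (unturnF k) (1 + k * ((cc + 387) * ℓ ^ 2)) := by
  induction k with
  | zero => exact (FC.lg hTurn_bijective).mono (by omega)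
  | succ k ih =>
    refine ((FC.back h2 hk (by omega)).comp (ih (by omega))).mono ?_
    exact le_of_eq (by ring)

theorem unturnF_of_ne {ℓ : ℕ} (k : ℕ) (p : ZMod ℓ) (a : Arrow) (r : Fin 2 × Fin 6)
    (t : ZMod ℓ → Letter) (h : t p ≠ 0) (x : HC ℓ) (hx : gateF (lg hTurn) x = cf p a 0 r t) :
    unturnF k x = cf p a 0 r t := by
  induction k with
  | zero => exact hx
  | succ k ih => rw [unturnF, Function.comp_apply, ih, backF_zero_of_ne _ _ _ _ _ h]

theorem unturnF_filled {ℓ : ℕ} (k : ℕ) (p : ZMod ℓ) (a : Arrow) (r : Fin 2 × Fin 6)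
    (t : ZMod ℓ → Letter) (h : t p ≠ 0) (ha : ty a = 1) :
    unturnF k (cf p (wt (fl a) (t p)) 0 r (Function.update t p 0)) = cf p a 0 r t := by
  refine unturnF_of_ne k p a r t h _ ?_
  simp [gateF, lg, cf, hTurn, ty_wt _ _ h, fl_wt, fl_fl, wt_wt, ← ha, wt_ty]

theorem unturnF_hollow {ℓ : ℕ} (k : ℕ) (p : ZMod ℓ) (a : Arrow) (r : Fin 2 × Fin 6)
    (t : ZMod ℓ → Letter) (h : t p ≠ 0) (ha : ty a = 2) :
    unturnF k (cf p a 0 r t) = cf p a 0 r t := by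
  refine unturnF_of_ne k p a r t h _ ?_
  simp [gateF, lg, cf, hTurn, ha, h]

theorem unturnF_turning {ℓ : ℕ} {m k : ℕ} (hm0 : 1 ≤ m) (hmk : m ≤ k) (hk : k ≤ ℓ)
    (p : ZMod ℓ) (a : Arrow) (r : Fin 2 × Fin 6)
    (t : ZMod ℓ → Letter) (h : ∀ j < m, t (p + sd a * j) = 0) (h' : m < ℓ → t (p + sd a * m) ≠ 0) :
    unturnF k (cf (p + (sd a : ZMod ℓ) * (m : ZMod ℓ)) (wt (fl a) 1) 0 r
      (Function.update t p (ty a))) = cf p a 0 r t := by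
  have hs := sd_eq a
  have hp0 : t p = 0 := by simpa using h 0 hm0
  have hu : ∀ j, 1 ≤ j → j < ℓ → Function.update t p (ty a) (p + sd a * j) = t (p + sd a * j) := by
    intro j hj hj'
    have := update_off p hs hj' (by omega : 0 < ℓ) t (ty a)
    simp only [Nat.cast_zero, mul_zero, add_zero] at this
    rw [this, if_neg (by omega)]
  have hsd : sd (wt (fl a) 1) = -sd a := by rw [sd_wt, sd_fl]
  have key : ∀ k < m, unturnF k (cf (p + (sd a : ZMod ℓ) * (m : ZMod ℓ)) (wt (fl a) 1) 0 r
      (Function.update t p (ty a))) = cf (p + (sd a : ZMod ℓ) * (m : ZMod ℓ)) (wt (fl a) 1) 1 r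
      (Function.update t p (ty a)) := by
    intro k hk
    induction k with
    | zero =>
      have hne : Function.update t p (ty a) (p + sd a * m) ≠ 0 := by
        rcases (show m ≤ ℓ by omega).lt_or_eq with h1 | h1
        · rw [hu m hm0 h1]; exact h' h1
        · rw [h1, ZMod.natCast_self, mul_zero, add_zero, Function.update_self]; exact ty_ne_zero a
      simp [unturnF, gateF, lg, cf, hTurn, hne, ty_wt]
    | succ k ih =>
      rw [unturnF, Function.comp_apply, ih (by omega), backF_one_of_eq]
      have : p + (sd a : ZMod ℓ) * (m : ZMod ℓ) + (sd (wt (fl a) 1) : ZMod ℓ) *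
          ((k + 1 : ℕ) : ZMod ℓ) = p + (sd a : ZMod ℓ) * ((m - (k + 1) : ℕ) : ZMod ℓ) := by
        rw [hsd, Nat.cast_sub hk.le]; push_cast; ring
      rw [this, hu _ (by omega) (by omega)]
      exact h _ (by omega)
  induction k, hmk using Nat.le_induction with
  | base =>
    obtain ⟨n, rfl⟩ : ∃ n, m = n + 1 := ⟨m - 1, by omega⟩
    rw [unturnF, Function.comp_apply, key n (by omega)]
    simp only [backF, Function.comp_apply]
    have hp : p + (sd a : ZMod ℓ) * ((n + 1 : ℕ) : ZMod ℓ) + (sd (wt (fl a) 1) : ZMod ℓ) *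
        ((n + 1 : ℕ) : ZMod ℓ) = p := by rw [hsd]; push_cast; ring
    rw [shiftF_one, hp, startF_of_eq hm0 hk, cellF_cf]
    · simp [hStart, ty_wt, ty_ne_zero, wt_wt]
      simp [shiftF, cf, gateF, lg, hFlip, fl_wt, fl_fl, wt_ty, ← hp0]
    · intro i hi hi'
      rw [hsd]
      simpa [hu i hi (by omega)] using h i hi'
    · intro hl
      rw [hsd]
      have h1 := h' hl
      rw [← hu _ hm0 hl] at h1
      simpa using h1
  | succ k hmk ih =>
    rw [unturnF, Function.comp_apply, ih (by omega),
      backF_zero_of_lt hk hm0 (by omega) p a r t (h' (by omega))]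

/-- The direction in which a big step arrives in an arrow. -/
def mv (a : Arrow) : ℤ := if ty a = 1 then -sd a else sd a

/-- Two double steps of the machine, up to conjugation. -/
def bigStep {ℓ : ℕ} (x : HC ℓ) : HC ℓ :=
  if x.t x.p = 0 then
    ⟨x.p + (sd x.q.1.1 : ZMod ℓ), ((wt (fl x.q.1.1) 1, x.q.1.2), x.q.2),
      Function.update x.t x.p (ty x.q.1.1)⟩
  else if ty x.q.1.1 = 1 then
    ⟨x.p + (sd x.q.1.1 : ZMod ℓ), ((wt x.q.1.1 2, x.q.1.2), x.q.2), x.t⟩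
  else
    ⟨x.p + (mv (wt (fl x.q.1.1) (x.t x.p)) : ZMod ℓ), ((wt (fl x.q.1.1) (x.t x.p), x.q.1.2), x.q.2),
      Function.update x.t x.p 0⟩

section bigStep

variable {ℓ : ℕ} (p : ZMod ℓ) (a : Arrow) (d : Fin 2) (r : Fin 2 × Fin 6) (t : ZMod ℓ → Letter)

theorem bigStep_zero (h : t p = 0) : bigStep (cf p a d r t) =
    cf (p + (sd a : ZMod ℓ)) (wt (fl a) 1) d r (Function.update t p (ty a)) := by
  simp [bigStep, cf, h]

theorem bigStep_filled (h : t p ≠ 0) (ha : ty a = 1) : bigStep (cf p a d r t) =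
    cf (p + (sd a : ZMod ℓ)) (wt a 2) d r t := by
  simp [bigStep, cf, h, ha]

theorem bigStep_hollow (h : t p ≠ 0) (ha : ty a = 2) : bigStep (cf p a d r t) =
    cf (p + (mv (wt (fl a) (t p)) : ZMod ℓ)) (wt (fl a) (t p)) d r (Function.update t p 0) := by
  simp [bigStep, cf, h, ha]

end bigStep

/-- There are exactly `m` zeros in front of the head, or the whole tape is zero and `m = ℓ`. -/
structure IsNode {ℓ : ℕ} (m : ℕ) (p : ZMod ℓ) (a : Arrow) (t : ZMod ℓ → Letter) : Prop where
  le : m ≤ ℓ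
  zero : ∀ j < m, t (p + (sd a : ZMod ℓ) * (j : ZMod ℓ)) = 0
  ne : m < ℓ → t (p + (sd a : ZMod ℓ) * (m : ZMod ℓ)) ≠ 0

/-- The first configuration of the sweep of a node. -/
def startC {ℓ : ℕ} (m : ℕ) (p : ZMod ℓ) (a : Arrow) (r : Fin 2 × Fin 6) (t : ZMod ℓ → Letter) :
    HC ℓ :=
  if m = 0 ∧ ty a = 1 then cf p (wt (fl a) (t p)) 0 r (Function.update t p 0) else cf p a 0 r t

theorem IsNode.update_apply {ℓ : ℕ} {m : ℕ} {p : ZMod ℓ} {a : Arrow} {t : ZMod ℓ → Letter}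
    (_h : IsNode m p a t) {j : ℕ} (hj : 1 ≤ j) (hjl : j < ℓ) :
    Function.update t p (ty a) (p + sd a * j) = t (p + sd a * j) := by
  have := update_off p (sd_eq a) hjl (by omega : 0 < ℓ) t (ty a)
  simp only [Nat.cast_zero, mul_zero, add_zero] at this
  rw [this, if_neg (by omega)]

theorem IsNode.update_ne {ℓ : ℕ} {m : ℕ} {p : ZMod ℓ} {a : Arrow} {t : ZMod ℓ → Letter}
    (h : IsNode m p a t) (hm : 1 ≤ m) :
    Function.update t p (ty a) (p + sd a * m) ≠ 0 := by
  rcases h.le.lt_or_eq with h1 | h1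
  · rw [h.update_apply hm h1]; exact h.ne h1
  · rw [h1, ZMod.natCast_self, mul_zero, add_zero, Function.update_self]; exact ty_ne_zero a

theorem IsNode.child {ℓ : ℕ} {m : ℕ} {p : ZMod ℓ} {a : Arrow} {t : ZMod ℓ → Letter}
    (h : IsNode m p a t) {k : ℕ} (hk : k < m) (c : Letter) :
    IsNode k (p + (sd a : ZMod ℓ) * (k : ZMod ℓ)) (wt (fl a) c) (Function.update t p (ty a)) := by
  have hsd : sd (wt (fl a) c) = -sd a := by rw [sd_wt, sd_fl]
  have hle := h.le
  refine ⟨by omega, fun j hj => ?_, fun _ => ?_⟩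
  · have : p + (sd a : ZMod ℓ) * (k : ZMod ℓ) + (sd (wt (fl a) c) : ZMod ℓ) * (j : ZMod ℓ) =
        p + (sd a : ZMod ℓ) * ((k - j : ℕ) : ZMod ℓ) := by
      rw [hsd, Nat.cast_sub hj.le]; push_cast; ring
    rw [this, h.update_apply (by omega) (by omega)]
    exact h.zero _ (by omega)
  · have : p + (sd a : ZMod ℓ) * (k : ZMod ℓ) + (sd (wt (fl a) c) : ZMod ℓ) * (k : ZMod ℓ) = p := by
      rw [hsd]; push_cast; ring
    rw [this, Function.update_self]
    exact ty_ne_zero a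

theorem gk_succ (k : ℕ) : gk (k + 1) = gk k + 3 ^ k := by
  have h1 := two_mul_gk k
  have h2 := two_mul_gk (k + 1)
  rw [pow_succ] at h2
  omega

theorem gk_mono {k m : ℕ} (h : k ≤ m) : gk k ≤ gk m := by
  induction m, h using Nat.le_induction with
  | base => exact le_rfl
  | succ m _ ih => rw [gk_succ]; exact ih.trans (Nat.le_add_right _ _)

/-- The sweep of a node with `m` zeros takes `3 ^ m` steps. -/
theorem IsNode.sweep {ℓ : ℕ} (r : Fin 2 × Fin 6) {m : ℕ} (hm : 1 ≤ m) {p : ZMod ℓ} {a : Arrow}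
    {t : ZMod ℓ → Letter} (h : IsNode m p a t) :
    (∀ k, 1 ≤ k → k ≤ m → bigStep^[gk k] (cf p a 0 r t) =
      cf (p + (sd a : ZMod ℓ) * (k : ZMod ℓ)) (wt (fl a) 1) 0 r (Function.update t p (ty a))) ∧
    (∀ k < m, bigStep^[3 ^ m - gk (k + 1)] (cf p a 0 r t) =
      cf (p + (sd a : ZMod ℓ) * (k : ZMod ℓ)) (wt (fl a) 2) 0 r (Function.update t p (ty a))) ∧
    bigStep^[3 ^ m] (cf p a 0 r t) = cf (p + (mv a : ZMod ℓ)) a 0 r t := by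
  induction m using Nat.strong_induction_on generalizing p a t with
  | _ m ih =>
  have hp0 : t p = 0 := by simpa using h.zero 0 hm
  have hle := h.le
  have hA : ∀ k, 1 ≤ k → k ≤ m → bigStep^[gk k] (cf p a 0 r t) =
      cf (p + (sd a : ZMod ℓ) * (k : ZMod ℓ)) (wt (fl a) 1) 0 r (Function.update t p (ty a)) := by
    intro k hk1 hkm
    induction k, hk1 using Nat.le_induction with
    | base =>
      rw [show gk 1 = 1 from rfl, Function.iterate_one, bigStep_zero p a 0 r t hp0]
      simp
    | succ k hk1 ihk =>
      rw [gk_succ, add_comm, Function.iterate_add_apply, ihk (by omega),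
        (ih k (by omega) hk1 (h.child (by omega) 1)).2.2]
      congr 1
      rw [mv, ty_wt _ _ (by decide), if_pos rfl, sd_wt, sd_fl]
      push_cast; ring
  have hC : ∀ j < m, bigStep^[3 ^ m - gk (m - 1 - j + 1)] (cf p a 0 r t) =
      cf (p + (sd a : ZMod ℓ) * ((m - 1 - j : ℕ) : ZMod ℓ)) (wt (fl a) 2) 0 r
        (Function.update t p (ty a)) := by
    intro j hj
    induction j with
    | zero =>
      have e : 3 ^ m - gk (m - 1 - 0 + 1) = 1 + gk m := by
        have := two_mul_gk m
        rw [Nat.sub_zero, Nat.sub_add_cancel hm]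
        omega
      rw [e, Function.iterate_add_apply, hA m hm le_rfl, Function.iterate_one,
        bigStep_filled _ _ _ _ _ (h.update_ne hm) (ty_wt _ _ (by decide)), wt_wt, sd_wt, sd_fl]
      congr 1
      rw [Nat.sub_zero, Nat.cast_sub hm]
      push_cast; ring
    | succ j ihj =>
      have e : 3 ^ m - gk (m - 1 - (j + 1) + 1) = 3 ^ (m - 1 - j) + (3 ^ m - gk (m - 1 - j + 1)) := by
        have h1 := two_mul_gk m
        have h2 := gk_mono (show m - 1 - j + 1 ≤ m by omega)
        have h3 := gk_succ (m - 1 - j)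
        rw [show m - 1 - (j + 1) + 1 = m - 1 - j by omega]
        generalize 3 ^ m = x at *
        generalize 3 ^ (m - 1 - j) = y at *
        omega
      rw [e, Function.iterate_add_apply, ihj (by omega),
        (ih (m - 1 - j) (by omega) (by omega) (h.child (by omega) 2)).2.2]
      congr 1
      rw [mv, ty_wt _ _ (by decide), if_neg (by decide), sd_wt, sd_fl,
        show m - 1 - j = m - 1 - (j + 1) + 1 by omega]
      push_cast; ring
  have hC' : ∀ k < m, bigStep^[3 ^ m - gk (k + 1)] (cf p a 0 r t) =
      cf (p + (sd a : ZMod ℓ) * (k : ZMod ℓ)) (wt (fl a) 2) 0 r (Function.update t p (ty a)) := by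
    intro k hk
    have := hC (m - 1 - k) (by omega)
    rwa [show m - 1 - (m - 1 - k) = k by omega] at this
  refine ⟨hA, hC', ?_⟩
  have e : 3 ^ m = 1 + (3 ^ m - gk (0 + 1)) := by
    rw [show gk (0 + 1) = 1 from rfl]
    have : 0 < 3 ^ m := by positivity
    omega
  rw [e, Function.iterate_add_apply, hC' 0 hm, Function.iterate_one, Nat.cast_zero, mul_zero,
    add_zero, bigStep_hollow _ _ _ _ _ (by rw [Function.update_self]; exact ty_ne_zero a)
      (ty_wt _ _ (by decide)), Function.update_self, Function.update_idem, fl_wt, fl_fl, wt_wt,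
      wt_ty, ← hp0, Function.update_eq_self]

theorem IsNode.iterate_filled {ℓ : ℕ} (r : Fin 2 × Fin 6) {m : ℕ} {p : ZMod ℓ} {a : Arrow}
    {t : ZMod ℓ → Letter} (h : IsNode m p a t) {k : ℕ} (hk : k < m) :
    bigStep^[gk k] (startC m p a r t) =
      startC k (p + (sd a : ZMod ℓ) * (k : ZMod ℓ)) (wt (fl a) 1) r (Function.update t p (ty a)) := by
  have hp0 : t p = 0 := by simpa using h.zero 0 (by omega)
  rw [startC, if_neg (by omega)]
  rcases Nat.eq_zero_or_pos k with rfl | hk0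
  · rw [startC, if_pos ⟨rfl, ty_wt _ _ (by decide)⟩, Nat.cast_zero, mul_zero, add_zero,
      Function.update_self, Function.update_idem, fl_wt, fl_fl, wt_wt,
      wt_ty, ← hp0, Function.update_eq_self]
    rfl
  · rw [startC, if_neg (by omega)]
    exact (h.sweep r (by omega)).1 k hk0 hk.le

theorem IsNode.iterate_hollow {ℓ : ℕ} (r : Fin 2 × Fin 6) {m : ℕ} {p : ZMod ℓ} {a : Arrow}
    {t : ZMod ℓ → Letter} (h : IsNode m p a t) {k : ℕ} (hk : k < m) :
    bigStep^[3 ^ m - gk (k + 1)] (startC m p a r t) =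
      startC k (p + (sd a : ZMod ℓ) * (k : ZMod ℓ)) (wt (fl a) 2) r (Function.update t p (ty a)) := by
  rw [startC, if_neg (by omega), startC, if_neg (by rw [ty_wt _ _ (by decide)]; simp)]
  exact (h.sweep r (by omega)).2.1 k hk

/-- The encoding of sweeps with `k` digits. -/
noncomputable def encF {ℓ : ℕ} : ℕ → HC ℓ → HC ℓ
  | 0 => unturnF ℓ
  | k + 1 => stepF k ∘ encF k

theorem FC.enc {ℓ : ℕ} (h2 : 2 ≤ ℓ) {k : ℕ} (hk : k ≤ ℓ) :
    FC (ℓ := ℓ) (encF k) ((cc + 388) * ℓ ^ 3 + k * ((3 * cc + 2200) * ℓ ^ 3)) := by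
  induction k with
  | zero =>
    refine (FC.unturn h2 le_rfl).mono ?_
    have : 1 ≤ ℓ ^ 3 := Nat.one_le_pow _ _ (by omega)
    have e : ℓ * ((cc + 387) * ℓ ^ 2) = (cc + 387) * ℓ ^ 3 := by ring
    rw [e]
    nlinarith
  | succ k ih => exact ((FC.step h2 hk).comp (ih (by omega))).mono (le_of_eq (by ring))

/-- The encoding is correct on the sweeps of all nodes with at least `k` zeros. -/
structure EncOK (ℓ k : ℕ) : Prop where
  first : ∀ (r : Fin 2 × Fin 6) (m : ℕ) (p : ZMod ℓ) (a : Arrow) (t : ZMod ℓ → Letter),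
    IsNode m p a t → k ≤ m → ∀ s < gk k,
    encF k (bigStep^[s] (startC m p a r t)) = cf p a 0 r (wr p (sd a) k (s + gk k + 1) t)
  last : ∀ (r : Fin 2 × Fin 6) (m : ℕ) (p : ZMod ℓ) (a : Arrow) (t : ZMod ℓ → Letter),
    IsNode m p a t → k ≤ m → ∀ s < gk k,
    encF k (bigStep^[3 ^ m - gk k + s] (startC m p a r t)) = cf p a 0 r (wr p (sd a) k (s + 1) t)
  mid : ∀ (r : Fin 2 × Fin 6) (m : ℕ) (p : ZMod ℓ) (a : Arrow) (t : ZMod ℓ → Letter),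
    IsNode m p a t → k ≤ m →
    encF k (bigStep^[gk m] (startC m p a r t)) = cf p a 0 r (wr p (sd a) k 0 t)

theorem EncOK.all {ℓ k : ℕ} (H : EncOK ℓ k) (r : Fin 2 × Fin 6) (p : ZMod ℓ) (a : Arrow)
    (t : ZMod ℓ → Letter) (h : IsNode k p a t) {s : ℕ} (hs : s < 3 ^ k) :
    encF k (bigStep^[s] (startC k p a r t)) = cf p a 0 r (wr p (sd a) k (s + gk k + 1) t) := by
  have hg := two_mul_gk k
  rcases lt_trichotomy s (gk k) with h1 | h1 | h1
  · exact H.first r k p a t h le_rfl s h1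
  · rw [h1, H.mid r k p a t h le_rfl]
    rw [wr_congr p k (N := 0) (N' := gk k + gk k + 1)]
    rw [show gk k + gk k + 1 = 3 ^ k by omega]
    simp
  · have := H.last r k p a t h le_rfl (s - gk k - 1) (by omega)
    rw [show 3 ^ k - gk k + (s - gk k - 1) = s by omega] at this
    rw [this, wr_congr p k]
    rw [show s + gk k + 1 = s - gk k - 1 + 1 + 3 ^ k by omega, Nat.add_mod_right]

theorem EncOK.base {ℓ : ℕ} [NeZero ℓ] : EncOK ℓ 0 := by
  refine ⟨fun r m p a t h hk s hs => by simp [gk] at hs, fun r m p a t h hk s hs => by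
    simp [gk] at hs, fun r m p a t h _ => ?_⟩
  rw [wr_zero, encF]
  have hpos : 0 < ℓ := Nat.pos_of_ne_zero (NeZero.ne ℓ)
  rcases Nat.eq_zero_or_pos m with rfl | hm
  · have hne : t p ≠ 0 := by simpa using h.ne hpos
    rw [show gk 0 = 0 from rfl, Function.iterate_zero, id, startC]
    rcases ty_eq a with ha | ha
    · rw [if_pos ⟨rfl, ha⟩, unturnF_filled _ _ _ _ _ hne ha]
    · rw [if_neg (by rw [ha]; simp), unturnF_hollow _ _ _ _ _ hne ha]
  · rw [startC, if_neg (by omega), (h.sweep r hm).1 m hm le_rfl]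
    exact unturnF_turning hm h.le le_rfl p a r t h.zero h.ne

theorem EncOK.succ {ℓ : ℕ} [NeZero ℓ] {k : ℕ} (H : EncOK ℓ k) : EncOK ℓ (k + 1) := by
  have hg := two_mul_gk k
  have hg1 := gk_succ k
  have own : ∀ (r : Fin 2 × Fin 6) (m : ℕ) (p : ZMod ℓ) (a : Arrow) (t : ZMod ℓ → Letter),
      IsNode m p a t → k < m → ∀ N < 3 ^ k, stepF k (cf p a 0 r (wr p (sd a) k N t)) =
      cf p a 0 r (wr p (sd a) (k + 1) (if N = 0 then 0 else N + 3 ^ k) t) := by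
    intro r m p a t h hk N hN
    have := h.le
    exact stepF_zero (by omega) p a r hN t (h.zero k hk)
  have child : ∀ (r : Fin 2 × Fin 6) (m : ℕ) (p : ZMod ℓ) (a : Arrow) (t : ZMod ℓ → Letter),
      IsNode m p a t → k < m → ∀ c : Letter, c ≠ 0 → ∀ s < 3 ^ k,
      stepF k (encF k (bigStep^[s] (startC k (p + (sd a : ZMod ℓ) * (k : ZMod ℓ)) (wt (fl a) c) r
        (Function.update t p (ty a))))) =
      cf p a 0 r (wr p (sd a) (k + 1) (turnCode k (s + gk k + 1) c) t) := by
    intro r m p a t h hk c hc s hs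
    have hle := h.le
    have hsd : sd (wt (fl a) c) = -sd a := by rw [sd_wt, sd_fl]
    have hp : p + (sd a : ZMod ℓ) * (k : ZMod ℓ) + (sd (wt (fl a) c) : ZMod ℓ) * (k : ZMod ℓ) = p := by
      rw [hsd]; push_cast; ring
    rw [H.all r _ _ _ (h.child hk c) hs, stepF_ne (by omega), hp, Function.update_self, fl_wt,
      fl_fl, wt_wt, wt_ty, ty_wt _ _ hc, hsd, neg_neg]
    · congr 1
      refine wr_irrel p _ _ fun i hi => Function.update_of_ne ?_ _ _
      rintro rfl
      simp [off] at hi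
    · rw [hp, Function.update_self]
      exact ty_ne_zero a
  refine ⟨fun r m p a t h hk s hs => ?_, fun r m p a t h hk s hs => ?_, fun r m p a t h hk => ?_⟩
  · rw [encF, Function.comp_apply]
    rcases Nat.lt_or_ge s (gk k) with h1 | h1
    · rw [H.first r m p a t h (by omega) s h1, own r m p a t h hk _ (by omega), if_neg (by omega),
        show s + gk k + 1 + 3 ^ k = s + gk (k + 1) + 1 by omega]
    · obtain ⟨s', rfl⟩ := Nat.exists_eq_add_of_le h1
      rw [add_comm, Function.iterate_add_apply, h.iterate_filled r hk,
        child r m p a t h hk 1 (by decide) s' (by omega), turnCode, if_pos rfl,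
        show s' + gk k + 1 + gk k = s' + 3 ^ k by omega, Nat.add_mod_right,
        Nat.mod_eq_of_lt (by omega), show s' + gk k + gk (k + 1) + 1 = s' + 2 * 3 ^ k by omega]
  · rw [encF, Function.comp_apply]
    have hgm := gk_mono hk
    have hg2 := two_mul_gk m
    rcases Nat.lt_or_ge s (3 ^ k) with h1 | h1
    · rw [add_comm, Function.iterate_add_apply, h.iterate_hollow r hk,
        child r m p a t h hk 2 (by decide) s h1, turnCode, if_neg (by decide),
        show s + gk k + 1 + (gk k + 1) = s + 1 + 3 ^ k by omega, Nat.add_mod_right]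
      congr 2
      rcases Nat.lt_or_ge (s + 1) (3 ^ k) with h2 | h2
      · rw [Nat.mod_eq_of_lt h2, if_neg (by omega)]
      · rw [show s + 1 = 3 ^ k by omega, Nat.mod_self, if_pos rfl]
    · obtain ⟨s', rfl⟩ := Nat.exists_eq_add_of_le h1
      rw [show 3 ^ m - gk (k + 1) + (3 ^ k + s') = 3 ^ m - gk k + s' by omega,
        H.last r m p a t h (by omega) s' (by omega), own r m p a t h hk _ (by omega),
        if_neg (by omega), show s' + 1 + 3 ^ k = 3 ^ k + s' + 1 by omega]
  · rw [encF, Function.comp_apply, H.mid r m p a t h (by omega), own r m p a t h hk 0 (by positivity),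
      if_pos rfl]

theorem encOK (ℓ : ℕ) [NeZero ℓ] (k : ℕ) : EncOK ℓ k := by
  induction k with
  | zero => exact EncOK.base
  | succ k ih => exact ih.succ

theorem isNode_zero {ℓ : ℕ} (p : ZMod ℓ) (a : Arrow) : IsNode ℓ p a (fun _ => 0) :=
  ⟨le_rfl, fun _ _ => rfl, fun h => absurd h (lt_irrefl ℓ)⟩

/-- The mask of duck `0`. -/
def duckZero (_ : Arrow) (d : Fin 2) : Bool := d == 0

/-- The position of a configuration on its orbit, in ternary. -/
noncomputable def orbF {ℓ : ℕ} : HC ℓ → HC ℓ := addF duckZero (gk ℓ) ℓ ∘ encF ℓ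

theorem FC.orb {ℓ : ℕ} (h2 : 2 ≤ ℓ) : FC (ℓ := ℓ) orbF ((5 * cc + 2781) * ℓ ^ 4) := by
  refine ((FC.add h2 duckZero (gk ℓ) le_rfl).comp (FC.enc h2 le_rfl)).mono ?_
  have h3 : (2 * cc + 581) * ℓ ^ 3 ≤ (2 * cc + 581) * ℓ ^ 4 :=
    Nat.mul_le_mul_left _ (Nat.pow_le_pow_right (by omega) (by omega))
  calc _ = (cc + 193 + (cc + 388)) * ℓ ^ 3 + (3 * cc + 2200) * ℓ ^ 4 := by ring
    _ ≤ (5 * cc + 2781) * ℓ ^ 4 := by nlinarith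

theorem orbF_iterate {ℓ : ℕ} [NeZero ℓ] (p : ZMod ℓ) (a : Arrow) (r : Fin 2 × Fin 6) {s : ℕ}
    (hs : s < 3 ^ ℓ) :
    orbF (bigStep^[s] (cf p a 0 r fun _ => 0)) = cf p a 0 r (wr p (sd a) ℓ s fun _ => 0) := by
  have h := (encOK ℓ ℓ).all r p a _ (isNode_zero p a) hs
  rw [startC, if_neg (by have := NeZero.ne ℓ; tauto)] at h
  rw [orbF, Function.comp_apply, h, addF_of_mem _ _ _ le_rfl p rfl]
  congr 1
  refine wr_congr p ℓ ?_ _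
  have := two_mul_gk ℓ
  rw [show s + gk ℓ + 1 + gk ℓ = s + 3 ^ ℓ by omega, Nat.add_mod_right]

theorem bigStep_period {ℓ : ℕ} [NeZero ℓ] (p : ZMod ℓ) (a : Arrow) (r : Fin 2 × Fin 6) :
    bigStep^[3 ^ ℓ] (cf p a 0 r fun _ => 0) = cf (p + (mv a : ZMod ℓ)) a 0 r fun _ => 0 :=
  ((isNode_zero p a).sweep r (Nat.pos_of_ne_zero (NeZero.ne ℓ))).2.2

/-- The configuration with the number `N` written on the whole tape. -/
def code {ℓ : ℕ} (p : ZMod ℓ) (a : Arrow) (d : Fin 2) (r : Fin 2 × Fin 6) (N : ℕ) : HC ℓ :=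
  cf p a d r (wr p (sd a) ℓ N fun _ => 0)

theorem exists_code {ℓ : ℕ} [NeZero ℓ] (p : ZMod ℓ) (a : Arrow) (d : Fin 2) (r : Fin 2 × Fin 6)
    (t : ZMod ℓ → Letter) : ∃ N < 3 ^ ℓ, cf p a d r t = code p a d r N := by
  have key : ∀ k ≤ ℓ, ∃ N < 3 ^ k, t = wr p (sd a) k N t := by
    intro k hk
    induction k with
    | zero => exact ⟨0, by norm_num, (wr_zero p 0 t).symm⟩
    | succ k ih =>
      obtain ⟨N, hN, ht⟩ := ih (by omega)
      have hlt := (t (p + sd a * k)).isLt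
      refine ⟨N + (t (p + sd a * k)).val * 3 ^ k, ?_, ?_⟩
      · have : (t (p + sd a * k)).val * 3 ^ k ≤ 2 * 3 ^ k := Nat.mul_le_mul_right _ (by omega)
        rw [pow_succ]
        omega
      · rw [wr_succ_eq p (sd_eq a) (by omega) hN, Function.update_eq_self]
        exact ht
  obtain ⟨N, hN, ht⟩ := key ℓ le_rfl
  refine ⟨N, hN, ?_⟩
  rw [code, ht]
  congr 1
  exact wr_irrel p ℓ N fun i hi => absurd (off_lt p (sd a) i) (not_lt.2 hi)

theorem code_congr {ℓ : ℕ} (p : ZMod ℓ) (a : Arrow) (d : Fin 2) (r : Fin 2 × Fin 6) {N N' : ℕ}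
    (h : N % 3 ^ ℓ = N' % 3 ^ ℓ) : code p a d r N = code p a d r N' := by
  rw [code, code, wr_congr p ℓ h]

theorem rotF_code {ℓ : ℕ} [NeZero ℓ] {μ : Arrow → Fin 2 → Bool} {a : Arrow} {d : Fin 2}
    (hμ : μ a d = true) (p : ZMod ℓ) (r : Fin 2 × Fin 6) (N : ℕ) (e : ℕ) :
    (rotF μ)^[e] (code p a d r N) = code (p + (sd a : ZMod ℓ) * (e : ZMod ℓ)) a d r N := by
  induction e with
  | zero => simp
  | succ e ih =>
    rw [Function.iterate_succ_apply', ih, code, rotF_of_mem hμ, code]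
    have h1 : p + (sd a : ZMod ℓ) * (e : ZMod ℓ) + (sd a : ZMod ℓ) =
        p + (sd a : ZMod ℓ) * ((e + 1 : ℕ) : ZMod ℓ) := by push_cast; ring
    rw [h1]
    congr 1
    funext i
    have h2 : off (p + (sd a : ZMod ℓ) * (e : ZMod ℓ)) (sd a) (i - (sd a : ZMod ℓ)) =
        off (p + (sd a : ZMod ℓ) * ((e + 1 : ℕ) : ZMod ℓ)) (sd a) i := by
      unfold off
      congr 1
      push_cast
      ring
    rw [wr, wr, h2]

/-- The arrow of the same side with the other type. -/
def ot (a : Arrow) : Arrow := wt a (if ty a = 1 then 2 else 1)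

theorem ot_ot (a : Arrow) : ot (ot a) = a := by revert a; decide
theorem sd_ot (a : Arrow) : sd (ot a) = sd a := sd_wt _ _
theorem ty_ot (a : Arrow) : ty (ot a) = if ty a = 1 then 2 else 1 := by revert a; decide

/-- Change the type if the duck is `0` and the letter satisfies `P`. -/
def hOther (P : Letter → Bool) (u : Arrow × Fin 2 × Letter) : Arrow × Fin 2 × Letter :=
  (if u.2.1 = 0 ∧ P u.2.2 then ot u.1 else u.1, u.2.1, u.2.2)

theorem hOther_bijective (P : Letter → Bool) : Function.Bijective (hOther P) := by
  apply Function.Involutive.bijective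
  rintro ⟨a, d, l⟩
  by_cases h : d = 0 ∧ P l <;> simp [hOther, h, ot_ot]

theorem sd_hOther (P : Letter → Bool) (u : Arrow × Fin 2 × Letter) :
    sd (hOther P u).1 = sd u.1 := by
  unfold hOther
  split_ifs <;> simp [sd_ot]

/-- Change the type if adding `n` to the number on the tape overflows. -/
noncomputable def ovF {ℓ : ℕ} (n : ℕ) : HC ℓ → HC ℓ :=
  ccellF (ℓ - 1) (-1) (carryList n (ℓ - 1)) (hOther fun l => l.val + (dg n (ℓ - 1)).val = 2) ∘
    cellF (ℓ - 1) (lg (hOther fun l => 3 ≤ l.val + (dg n (ℓ - 1)).val))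

theorem FC.ov {ℓ : ℕ} (h2 : 2 ≤ ℓ) (n : ℕ) : FC (ℓ := ℓ) (ovF n) ((cc + 193) * ℓ ^ 2) := by
  refine ((FC.ccell (hOther_bijective _) (sd_hOther _) (by omega) h2 rfl (disjoint_carryList n _)
    (by rw [length_carryList]; omega)).comp
    (FC.lcell (hOther_bijective _) (sd_hOther _) (by omega) (by omega))).mono ?_
  nlinarith

theorem ovF_one {ℓ : ℕ} (n : ℕ) (p : ZMod ℓ) (a : Arrow) (r : Fin 2 × Fin 6)
    (t : ZMod ℓ → Letter) : ovF n (cf p a 1 r t) = cf p a 1 r t := by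
  simp [ovF, cellF_cf, ccellF_cf, hOther]

theorem cellF_hOther_code {ℓ : ℕ} {j : ℕ} (hj : j < ℓ) (P : Letter → Bool) (p : ZMod ℓ)
    (a : Arrow) (r : Fin 2 × Fin 6) (N : ℕ) : cellF j (lg (hOther P)) (code p a 0 r N) =
      code p (if P (dg N j) then ot a else a) 0 r N := by
  have hl := wr_apply p (sd_eq a) hj ℓ N fun _ => 0
  rw [if_pos hj] at hl
  rw [code, cellF_cf, hl]
  simp only [hOther, true_and]
  rw [← hl, Function.update_eq_self, hl, code]
  split_ifs <;> simp only [sd_ot]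

theorem ovF_code {ℓ : ℕ} [NeZero ℓ] (n : ℕ) (p : ZMod ℓ) (a : Arrow) (r : Fin 2 × Fin 6) (N : ℕ) :
    ovF n (code p a 0 r N) =
      code p (if 3 ^ ℓ ≤ N % 3 ^ ℓ + n % 3 ^ ℓ then ot a else a) 0 r N := by
  obtain ⟨j, rfl⟩ : ∃ j, ℓ = j + 1 := ⟨ℓ - 1, by have := NeZero.ne ℓ; omega⟩
  have hc : ∀ (L : List (Set Letter × Set Letter)) (P : Letter → Bool) (b : Arrow),
      L = carryList n j → ccellF j (-1) L (hOther P) (code p b 0 r N) =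
      code p (if 3 ^ j ≤ N % 3 ^ j + n % 3 ^ j ∧ P (dg N j) then ot b else b) 0 r N := by
    rintro _ P b rfl
    have hscan := scanW_carryList p (sd_eq b) n N (Nat.le_succ j) (by omega) (fun _ => 0)
    rw [code, ccellF_cf, ← code, cellF_hOther_code (by omega)]
    by_cases h : 3 ^ j ≤ N % 3 ^ j + n % 3 ^ j
    · rw [if_pos (hscan.2 h)]
      simp only [h, true_and]
    · rw [if_neg (fun h' => h (hscan.1 h'))]
      simp only [h, false_and, if_false]
  simp only [ovF, Function.comp_apply, Nat.add_sub_cancel, cellF_hOther_code (Nat.lt_succ_self j),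
    hc _ _ _ rfl, carry_succ, decide_eq_true_eq]
  congr 1
  split_ifs <;> first | rfl | (exfalso; omega)

/-- The mask of duck `0` and type `b`. -/
def duckType (b : Letter) (a : Arrow) (d : Fin 2) : Bool := d == 0 && ty a == b

/-- Add `n` to the code of a configuration. -/
noncomputable def zF {ℓ : ℕ} (n : ℕ) : HC ℓ → HC ℓ :=
  addF duckZero n ℓ ∘ (rotF (duckType 2))^[n / 3 ^ ℓ % ℓ] ∘
    (rotF (duckType 1))^[(ℓ - 1) * (n / 3 ^ ℓ) % ℓ] ∘ ovF n ∘ rotF (duckType 1) ∘ ovF n ∘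
    (rotF (duckType 1))^[ℓ - 1]

theorem FC.z {ℓ : ℕ} (h2 : 2 ≤ ℓ) (n : ℕ) : FC (ℓ := ℓ) (zF n) ((3 * cc + 1355) * ℓ ^ 3) := by
  have hr : ∀ b k, k < ℓ → FC (ℓ := ℓ) (rotF (duckType b))^[k] (194 * ℓ ^ 2) := fun b k hk =>
    ((FC.rot (by omega) _).iterate k).mono (by nlinarith)
  refine ((FC.add h2 duckZero n le_rfl).comp ((hr 2 _ (Nat.mod_lt _ (by omega))).comp
    ((hr 1 _ (Nat.mod_lt _ (by omega))).comp ((FC.ov h2 n).comp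
    ((hr 1 1 (by omega)).comp ((FC.ov h2 n).comp (hr 1 _ (by omega)))))))).mono ?_
  have h3 : ℓ ^ 2 ≤ ℓ ^ 3 := Nat.pow_le_pow_right (by omega) (by norm_num)
  have h4 : cc * ℓ ^ 2 ≤ cc * ℓ ^ 3 := Nat.mul_le_mul_left _ h3
  have h5 : ℓ * ((cc + 193) * ℓ ^ 2) = cc * ℓ ^ 3 + 193 * ℓ ^ 3 := by ring
  rw [h5]
  linarith

theorem zF_one {ℓ : ℕ} (n : ℕ) (p : ZMod ℓ) (a : Arrow) (r : Fin 2 × Fin 6)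
    (t : ZMod ℓ → Letter) : zF n (cf p a 1 r t) = cf p a 1 r t := by
  have hr : ∀ b k, (rotF (duckType b))^[k] (cf p a 1 r t) = cf p a 1 r t := fun b k =>
    Function.iterate_fixed (rotF_of_notMem (by simp [duckType]) r t) k
  have hr1 := hr 1 1
  rw [Function.iterate_one] at hr1
  simp only [zF, Function.comp_apply, hr, hr1, ovF_one]
  exact addF_of_notMem _ _ _ _ rfl _ _

theorem rotF_duckType {ℓ : ℕ} [NeZero ℓ] (b : Letter) (p : ZMod ℓ) (a : Arrow)
    (r : Fin 2 × Fin 6) (N e : ℕ) : (rotF (duckType b))^[e] (code p a 0 r N) =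
      code (if ty a = b then p + (sd a : ZMod ℓ) * (e : ZMod ℓ) else p) a 0 r N := by
  split_ifs with h
  · exact rotF_code (by simp [duckType, h]) p r N e
  · exact Function.iterate_fixed (rotF_of_notMem (by simp [duckType, h]) _ _) e

theorem zF_code {ℓ : ℕ} [NeZero ℓ] (n : ℕ) (p : ZMod ℓ) (a : Arrow) (r : Fin 2 × Fin 6) {N : ℕ}
    (hN : N < 3 ^ ℓ) : zF n (code p a 0 r N) =
      code (p + (mv a : ZMod ℓ) * (((N + n) / 3 ^ ℓ : ℕ) : ZMod ℓ)) a 0 r (N + n) := by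
  have hl : 1 ≤ ℓ := Nat.pos_of_ne_zero (NeZero.ne ℓ)
  have hadd : ∀ q : ZMod ℓ, addF duckZero n ℓ (code q a 0 r N) = code q a 0 r (N + n) :=
    fun q => addF_of_mem duckZero n N le_rfl q rfl r _
  have hr1 := fun (q : ZMod ℓ) b => rotF_duckType 1 q b r N 1
  simp only [Function.iterate_one] at hr1
  have hdiv : (N + n) / 3 ^ ℓ = n / 3 ^ ℓ + if 3 ^ ℓ ≤ N % 3 ^ ℓ + n % 3 ^ ℓ then 1 else 0 := by
    rw [Nat.add_div (by positivity), Nat.div_eq_of_lt hN, zero_add]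
  simp only [zF, Function.comp_apply, rotF_duckType, hr1, ovF_code, hdiv, mv]
  have e1 : ((ℓ - 1 : ℕ) : ZMod ℓ) = -1 := by rw [Nat.cast_sub hl]; simp
  by_cases hc : 3 ^ ℓ ≤ N % 3 ^ ℓ + n % 3 ^ ℓ <;> rcases ty_eq a with ha | ha <;>
    simp [hc, ha, ot_ot, ty_ot, sd_ot, hadd, e1] <;> (congr 1; ring)

instance {ℓ : ℕ} [NeZero ℓ] : Finite (HC ℓ) :=
  Finite.of_injective (fun x : HC ℓ => (x.p, x.q, x.t)) fun x y h => by
    simp only [Prod.mk.injEq] at h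
    exact HC.ext h.1 h.2.1 h.2.2

theorem bigStep_duck {ℓ : ℕ} (x : HC ℓ) (n : ℕ) : (bigStep^[n] x).q.2 = x.q.2 := by
  induction n with
  | zero => rfl
  | succ n ih =>
    rw [Function.iterate_succ_apply', ← ih]
    unfold bigStep
    split_ifs <;> rfl

theorem bigStep_iterate_mod {ℓ : ℕ} [NeZero ℓ] (p : ZMod ℓ) (a : Arrow) (r : Fin 2 × Fin 6)
    (m : ℕ) : bigStep^[m] (cf p a 0 r fun _ => 0) =
      bigStep^[m % 3 ^ ℓ] (cf (p + (mv a : ZMod ℓ) * ((m / 3 ^ ℓ : ℕ) : ZMod ℓ)) a 0 r fun _ => 0) := by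
  have key : ∀ k : ℕ, bigStep^[3 ^ ℓ * k] (cf p a 0 r fun _ => 0) =
      cf (p + (mv a : ZMod ℓ) * (k : ZMod ℓ)) a 0 r fun _ => 0 := by
    intro k
    induction k with
    | zero => simp
    | succ k ih =>
      rw [Nat.mul_succ, add_comm, Function.iterate_add_apply, ih, bigStep_period]
      congr 1
      push_cast
      ring
  conv_lhs => rw [← Nat.mod_add_div m (3 ^ ℓ)]
  rw [Function.iterate_add_apply, key]

/-- The orbit coordinates are surjective on configurations of duck `0`. -/
theorem exists_orbF_eq {ℓ : ℕ} [NeZero ℓ] (y : HC ℓ) (hy : y.q.2.1 = 0) :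
    ∃ p a r, ∃ s < 3 ^ ℓ, y = code p a 0 r s ∧
      orbF (bigStep^[s] (cf p a 0 r fun _ => 0)) = y := by
  obtain ⟨p, a, d, r, t, rfl⟩ := exists_cf y
  obtain rfl : d = 0 := hy
  obtain ⟨s, hs, h⟩ := exists_code p a 0 r t
  exact ⟨p, a, r, s, hs, h, by rw [orbF_iterate p a r hs, h, code]⟩

theorem orbF_duck {ℓ : ℕ} (h2 : 2 ≤ ℓ) (x : HC ℓ) : (orbF x).q.2.1 = 0 ↔ x.q.2.1 = 0 := by
  have : NeZero ℓ := ⟨by omega⟩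
  let Φ : Equiv.Perm (HC ℓ) := Equiv.ofBijective orbF (FC.orb h2).bijective
  have h : ∀ y : HC ℓ, y.q.2.1 = 0 → (Φ⁻¹ y).q.2.1 = 0 := by
    intro y hy
    obtain ⟨p, a, r, s, _, _, h⟩ := exists_orbF_eq y hy
    have : Φ⁻¹ y = bigStep^[s] (cf p a 0 r fun _ => 0) := by
      rw [Equiv.Perm.inv_eq_iff_eq]
      exact h.symm
    rw [this, bigStep_duck]
    rfl
  constructor
  · intro hx
    simpa [Φ] using h (Φ x) hx
  · intro hx
    let f : {y : HC ℓ // y.q.2.1 = 0} → {y : HC ℓ // y.q.2.1 = 0} := fun y => ⟨Φ⁻¹ y.1, h y.1 y.2⟩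
    have hf : Function.Injective f := fun y z hyz =>
      Subtype.ext (Φ⁻¹.injective (congrArg Subtype.val hyz))
    obtain ⟨y, hy⟩ := Finite.surjective_of_injective hf ⟨x, hx⟩
    have hy' : Φ⁻¹ y.1 = x := congrArg Subtype.val hy
    rw [Equiv.Perm.inv_eq_iff_eq] at hy'
    rw [show orbF x = y.1 from hy'.symm]
    exact y.2

theorem zF_orbF {ℓ : ℕ} (h2 : 2 ≤ ℓ) (n : ℕ) (x : HC ℓ) :
    zF n (orbF x) = if x.q.2.1 = 0 then orbF (bigStep^[n] x) else orbF x := by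
  have : NeZero ℓ := ⟨by omega⟩
  split_ifs with hx
  · obtain ⟨p, a, r, s, hs, h1, h⟩ := exists_orbF_eq (orbF x) ((orbF_duck h2 x).2 hx)
    rw [h1, zF_code n p a r hs, ← (FC.orb h2).bijective.injective h, ← Function.iterate_add_apply,
      add_comm n s, bigStep_iterate_mod, orbF_iterate _ _ _ (Nat.mod_lt _ (by positivity)), ← code]
    exact code_congr _ _ _ _ (Nat.mod_mod _ _).symm
  · have hx' := fun h => hx ((orbF_duck h2 x).1 h)
    obtain ⟨p, a, d, r, t, h⟩ := exists_cf (orbF x)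
    rw [h] at hx' ⊢
    obtain rfl : d = 1 := by
      have : d ≠ 0 := hx'
      omega
    exact zF_one n p a r t

/-- Exchange the ducks. -/
def duckSwap (u : DQ × Letter) : DQ × Letter := ((u.1.1, (u.1.2.1 + 1, u.1.2.2)), u.2)

theorem duckSwap_involutive : Function.Involutive duckSwap := by
  rintro ⟨⟨q, d, x⟩, l⟩
  have h : ∀ d : Fin 2, d + 1 + 1 = d := by decide
  simp only [duckSwap, h]

theorem bigStep_duckSwap {ℓ : ℕ} (n : ℕ) (x : HC ℓ) :
    bigStep^[n] (gateF duckSwap x) = gateF duckSwap (bigStep^[n] x) := by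
  have h : Function.Semiconj (gateF (ℓ := ℓ) duckSwap) bigStep bigStep := by
    intro y
    simp only [gateF, duckSwap, bigStep, Function.update_eq_self]
    split_ifs <;> simp
  exact ((h.iterate_right n) x).symm

theorem exists_FC_bigStep : ∃ C : ℕ, ∀ ℓ : ℕ, 2 ≤ ℓ → ∀ n : ℕ,
    FC (ℓ := ℓ) bigStep^[n] (C * ℓ ^ 4) := by
  refine ⟨26 * cc + 13836, fun ℓ h2 n => ?_⟩
  let Φ : Equiv.Perm (HC ℓ) := Equiv.ofBijective orbF (FC.orb h2).bijective
  have hΦ : ∀ x, Φ.symm (orbF x) = x := fun x => Φ.symm_apply_apply x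
  have hu := ((FC.orb h2).inv (g := Φ.symm) hΦ).comp ((FC.z h2 n).comp (FC.orb h2))
  have huf : ∀ x, (Φ.symm ∘ zF n ∘ orbF) x = if x.q.2.1 = 0 then bigStep^[n] x else x := by
    intro x
    rw [Function.comp_apply, Function.comp_apply, zF_orbF h2]
    split_ifs <;> exact hΦ _
  generalize Φ.symm ∘ zF n ∘ orbF = u at hu huf
  have hX := FC.gate_fun (ℓ := ℓ) _ duckSwap_involutive.bijective
  refine ((hX.comp (hu.comp (hX.comp hu))).of_eq fun x => ?_).mono ?_
  · have hXX : ∀ y : HC ℓ, gateF duckSwap (gateF duckSwap y) = y := by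
      intro y
      rw [gateF_gateF, duckSwap_involutive.comp_self]
      simp [gateF]
    have hXd : ∀ y : HC ℓ, (gateF duckSwap y).q.2.1 = y.q.2.1 + 1 := fun y => rfl
    simp only [Function.comp_apply]
    rw [huf x]
    split_ifs with h
    · rw [huf, if_neg, hXX]
      rw [hXd, bigStep_duck, h]
      decide
    · rw [huf, if_pos, bigStep_duckSwap, hXX]
      rw [hXd]
      omega
  · have h3 : ℓ ^ 3 ≤ ℓ ^ 4 := Nat.pow_le_pow_right (by omega) (by norm_num)
    have h4 : cc * ℓ ^ 3 ≤ cc * ℓ ^ 4 := Nat.mul_le_mul_left _ h3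
    have h5 : 1 ≤ ℓ ^ 4 := Nat.one_le_pow _ _ (by omega)
    linarith

/-- The matching transitions, on arrows and letters. -/
def matchA (a : Arrow) (l : Letter) : Arrow × Letter :=
  if l = 0 then (wt (fl a) 1, ty a) else if ty a = 1 then (wt a 2, l) else (wt (fl a) l, 0)

theorem smartStep_eq (a : Arrow) (b : Fin 2) (l : Letter) : smartStep (a, b) l =
    if b = 1 then Sum.inr (mv a, (a, 0)) else Sum.inl (((matchA a l).1, 1), (matchA a l).2) := by
  revert a b l; decide

theorem bigStep_eq {ℓ : ℕ} (x : HC ℓ) : bigStep x =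
    ⟨x.p + (mv (matchA x.q.1.1 (x.t x.p)).1 : ZMod ℓ), (((matchA x.q.1.1 (x.t x.p)).1, x.q.1.2), x.q.2),
      Function.update x.t x.p (matchA x.q.1.1 (x.t x.p)).2⟩ := by
  have h1 : ∀ a : Arrow, mv (wt (fl a) 1) = sd a := by decide
  have h2 : ∀ a : Arrow, mv (wt a 2) = sd a := by decide
  unfold bigStep matchA
  split_ifs <;> simp [h1, h2]

/-- The step of the decorated machine on configurations that carry a head. -/
def tmF {ℓ : ℕ} (x : HC ℓ) : HC ℓ :=
  match decStep x.q (x.t x.p) with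
  | Sum.inl (q', b) => ⟨x.p, q', Function.update x.t x.p b⟩
  | Sum.inr (δ, q') => ⟨x.p + (δ : ZMod ℓ), q', x.t⟩

theorem tmF_eq {ℓ : ℕ} (x : HC ℓ) : tmF x = if x.q.1.2 = 1 then
    ⟨x.p + (mv x.q.1.1 : ZMod ℓ), ((x.q.1.1, 0), x.q.2), x.t⟩ else
    ⟨x.p, (((matchA x.q.1.1 (x.t x.p)).1, 1), x.q.2),
      Function.update x.t x.p (matchA x.q.1.1 (x.t x.p)).2⟩ := by
  obtain ⟨p, ⟨⟨a, b⟩, e⟩, t⟩ := x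
  simp only [tmF, decStep, smartStep_eq]
  split_ifs <;> rfl

/-- Change of the state and the letter in a step of the machine. -/
def matchG (u : DQ × Letter) : DQ × Letter :=
  if u.1.1.2 = 1 then (((u.1.1.1, 0), u.1.2), u.2)
  else ((((matchA u.1.1.1 u.2).1, 1), u.1.2), (matchA u.1.1.1 u.2).2)

theorem matchG_bijective : Function.Bijective matchG := by
  have hm : ∀ a l a' l', matchA a l = matchA a' l' → a = a' ∧ l = l' := by decide
  rw [← Finite.injective_iff_bijective]
  rintro ⟨⟨⟨a, b⟩, e⟩, l⟩ ⟨⟨⟨a', b'⟩, e'⟩, l'⟩ h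
  simp only [matchG] at h
  split_ifs at h with h1 h2 h2
  · simp_all
  · simp at h
  · simp at h
  · simp only [Prod.mk.injEq] at h
    obtain ⟨rfl, rfl⟩ := hm a l a' l' (Prod.ext h.1.1.1 h.2)
    have : b = b' := by omega
    simp_all

/-- The movement of the head in a step of the machine. -/
def headShift (q : DQ) : ℤ := if q.1.2 = 1 then mv q.1.1 else 0

theorem natAbs_headShift (q : DQ) : (headShift q).natAbs ≤ 1 := by
  have : ∀ a : Arrow, (mv a).natAbs ≤ 1 := by decide
  unfold headShift
  split_ifs
  · exact this _
  · simp

theorem tmF_eq_comp {ℓ : ℕ} (x : HC ℓ) : tmF x = gateF matchG (shiftF headShift x) := by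
  rw [tmF_eq]
  by_cases h : x.q.1.2 = 1 <;> simp [gateF, matchG, shiftF, headShift, h]

theorem bigStep_eq_comp {ℓ : ℕ} (x : HC ℓ) : bigStep x =
    (shiftF headShift ∘ gateF matchG)^[2] x := by
  rw [bigStep_eq]
  by_cases h : x.q.1.2 = 1
  · simp [gateF, matchG, shiftF, headShift, h]
  · have h0 : x.q.1.2 = 0 := by omega
    simp [gateF, matchG, shiftF, headShift, h0]

theorem exists_FC_tmF : ∃ C : ℕ, ∀ ℓ : ℕ, 2 ≤ ℓ → ∀ n : ℕ, FC (ℓ := ℓ) tmF^[n] (C * ℓ ^ 4) := by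
  obtain ⟨C, hC⟩ := exists_FC_bigStep
  refine ⟨C + 289, fun ℓ h2 n => ?_⟩
  have hS := FC.shift (ℓ := ℓ) headShift 1 natAbs_headShift
  have hS' := hS.inv (g := shiftF (-headShift)) (shiftF_inv headShift)
  have hT : FC (ℓ := ℓ) tmF 97 :=
    ((FC.gate_fun _ matchG_bijective).comp hS).of_eq tmF_eq_comp
  have hsemi : Function.Semiconj (shiftF (ℓ := ℓ) headShift) tmF
      (shiftF headShift ∘ gateF matchG) := fun x => by rw [tmF_eq_comp]; rfl
  have heven : ∀ m, FC (ℓ := ℓ) tmF^[2 * m] (C * ℓ ^ 4 + 192) := by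
    intro m
    refine ((hS'.comp ((hC ℓ h2 m).comp hS)).of_eq fun x => ?_).mono (by omega)
    rw [Function.comp_apply, Function.comp_apply, funext (bigStep_eq_comp (ℓ := ℓ)),
      ← Function.iterate_mul, ← (hsemi.iterate_right (2 * m)) x, shiftF_inv]
  have h5 : 1 ≤ ℓ ^ 4 := Nat.one_le_pow _ _ (by omega)
  have hle : C * ℓ ^ 4 + 289 ≤ (C + 289) * ℓ ^ 4 := by nlinarith
  obtain ⟨m, rfl | rfl⟩ := n.even_or_odd'
  · exact (heven m).mono (by omega)
  · rw [Function.iterate_succ']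
    exact (hT.comp (heven m)).mono (by omega)

/-- The cyclic configuration of a configuration with a head. -/
def emb {ℓ : ℕ} (x : HC ℓ) : CConf DQ Letter ℓ :=
  ⟨fun i => if i = x.p then Sum.inr (x.q, x.t i) else Sum.inl (x.t i), fun i j hi hj => by
    have key : ∀ k : ZMod ℓ, (if k = x.p then (Sum.inr (x.q, x.t k) : TSym DQ Letter)
        else Sum.inl (x.t k)).isRight = true → k = x.p := by
      intro k hk
      by_contra h
      simp [h] at hk
    rw [key i hi, key j hj]⟩

theorem emb_apply {ℓ : ℕ} (x : HC ℓ) (i : ZMod ℓ) :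
    (emb x).1 i = if i = x.p then Sum.inr (x.q, x.t i) else Sum.inl (x.t i) := rfl

theorem tapeLetter_emb {ℓ : ℕ} (x : HC ℓ) (i : ZMod ℓ) : tapeLetter ((emb x).1 i) = x.t i := by
  rw [emb_apply]
  split_ifs <;> rfl

theorem emb_eq_inr {ℓ : ℕ} {x : HC ℓ} {i : ZMod ℓ} {q : DQ} {a : Letter}
    (h : (emb x).1 i = Sum.inr (q, a)) : i = x.p ∧ q = x.q ∧ a = x.t i := by
  rw [emb_apply] at h
  split_ifs at h with hi
  simp only [Sum.inr.injEq, Prod.mk.injEq] at h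
  exact ⟨hi, h.1.symm, h.2.symm⟩

theorem emb_injective {ℓ : ℕ} : Function.Injective (emb (ℓ := ℓ)) := by
  intro x y h
  have ht : x.t = y.t := by
    funext i
    rw [← tapeLetter_emb, h, tapeLetter_emb]
  have hx : (emb y).1 x.p = Sum.inr (x.q, x.t x.p) := by rw [← h, emb_apply, if_pos rfl]
  obtain ⟨h1, h2, _⟩ := emb_eq_inr hx
  exact HC.ext h1 h2 ht

theorem mem_range_emb {ℓ : ℕ} {w : CConf DQ Letter ℓ} {i : ZMod ℓ} {q : DQ} {a : Letter}
    (h : w.1 i = Sum.inr (q, a)) : w ∈ Set.range emb := by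
  refine ⟨⟨i, q, fun j => tapeLetter (w.1 j)⟩, Subtype.ext (funext fun j => ?_)⟩
  rw [emb_apply]
  split_ifs with hj
  · subst hj
    change Sum.inr (q, tapeLetter (w.1 j)) = w.1 j
    rw [h]
    rfl
  · rcases hw : w.1 j with b | b
    · change Sum.inl (tapeLetter (w.1 j)) = _
      rw [hw]
      rfl
    · exact absurd (w.2 j i (by rw [hw]; rfl) (by rw [h]; rfl)) hj

theorem eq_inl_of_notMem_range {ℓ : ℕ} {w : CConf DQ Letter ℓ} (h : w ∉ Set.range emb)
    (i : ZMod ℓ) : ∃ a, w.1 i = Sum.inl a := by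
  rcases hw : w.1 i with b | b
  · exact ⟨b, rfl⟩
  · exact absurd (mem_range_emb hw) h

open Classical in
/-- Permutations of configurations with a head, acting trivially on head-free configurations. -/
noncomputable def liftHom {ℓ : ℕ} :
    Equiv.Perm (HC ℓ) →* Equiv.Perm (CConf DQ Letter ℓ) :=
  Equiv.Perm.extendDomainHom (Equiv.ofInjective emb emb_injective)

open Classical in
theorem liftHom_emb {ℓ : ℕ} (σ : Equiv.Perm (HC ℓ)) (x : HC ℓ) :
    liftHom σ (emb x) = emb (σ x) :=
  Equiv.Perm.extendDomain_apply_image σ (Equiv.ofInjective emb emb_injective) x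

open Classical in
theorem liftHom_of_notMem {ℓ : ℕ} (σ : Equiv.Perm (HC ℓ)) {w : CConf DQ Letter ℓ}
    (h : w ∉ Set.range emb) : liftHom σ w = w :=
  Equiv.Perm.extendDomain_apply_not_subtype σ (Equiv.ofInjective emb emb_injective) h

theorem IsGen.liftHom_mem {ℓ : ℕ} {σ : Equiv.Perm (HC ℓ)} (hσ : IsGen σ) :
    liftHom σ ∈ TMGens DQ Letter ℓ := by
  rcases hσ with ⟨g, hg⟩ | ⟨q, hq⟩
  · refine Or.inl ⟨g, fun w i => ?_⟩
    by_cases hw : w ∈ Set.range emb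
    · obtain ⟨x, rfl⟩ := hw
      rw [liftHom_emb, hg, emb_apply, emb_apply]
      by_cases hi : i = x.p
      · subst hi
        simp [gateF, gateApply]
      · simp [gateF, gateApply, hi]
    · rw [liftHom_of_notMem σ hw]
      obtain ⟨a, ha⟩ := eq_inl_of_notMem_range hw i
      rw [ha]
      rfl
  · refine Or.inr ⟨q, fun w => ⟨fun h => ?_, fun i a h j => ?_⟩⟩
    · by_cases hw : w ∈ Set.range emb
      · obtain ⟨x, rfl⟩ := hw
        rw [liftHom_emb, hq, moveF, if_neg]
        rintro rfl
        exact h x.p (x.t x.p) (by rw [emb_apply, if_pos rfl])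
      · exact liftHom_of_notMem σ hw
    · obtain ⟨x, rfl⟩ := mem_range_emb h
      obtain ⟨rfl, rfl, rfl⟩ := emb_eq_inr h
      rw [liftHom_emb, hq, moveF, if_pos rfl, tapeLetter_emb, emb_apply, emb_apply]
      dsimp only
      split_ifs with h1 h2
      · rw [h1]
      · rw [h2]
      · rfl

theorem arrivesAs_emb {ℓ : ℕ} (x : HC ℓ) (j : ZMod ℓ) (d : ℤ) :
    arrivesAs decStep ((emb x).1 j) d = if j = x.p ∧ x.q.1.2 = 1 ∧ mv x.q.1.1 = d then
      some ((x.q.1.1, 0), x.q.2) else none := by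
  obtain ⟨p, ⟨⟨a, b⟩, e⟩, t⟩ := x
  rw [emb_apply]
  by_cases hj : j = p
  · by_cases hb : b = 1
    · simp [hj, hb, arrivesAs, decStep, smartStep_eq]
    · simp [hj, hb, arrivesAs, decStep, smartStep_eq]
  · simp [hj, arrivesAs]

theorem stepC_emb {ℓ : ℕ} (h2 : 2 ≤ ℓ) (x : HC ℓ) :
    stepC decStep ℓ (emb x).1 = (emb (tmF x)).1 := by
  have : Fact (1 < ℓ) := ⟨h2⟩
  funext i
  have hd : decStep x.q (x.t x.p) = if x.q.1.2 = 1 then Sum.inr (mv x.q.1.1, ((x.q.1.1, 0), x.q.2))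
      else Sum.inl ((((matchA x.q.1.1 (x.t x.p)).1, 1), x.q.2), (matchA x.q.1.1 (x.t x.p)).2) := by
    obtain ⟨p, ⟨⟨a, b⟩, e⟩, t⟩ := x
    simp only [decStep, smartStep_eq]
    split_ifs <;> rfl
  have hmv : mv x.q.1.1 = 1 ∨ mv x.q.1.1 = -1 := by
    have : ∀ a : Arrow, mv a = 1 ∨ mv a = -1 := by decide
    exact this _
  rw [emb_apply, tmF_eq]
  by_cases hi : i = x.p
  · subst hi
    have hc : (emb x).1 x.p = Sum.inr (x.q, x.t x.p) := by rw [emb_apply, if_pos rfl]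
    simp only [stepC, localStep, hc, hd]
    by_cases hb : x.q.1.2 = 1
    · rcases hmv with h | h <;> simp [hb, h]
    · simp [hb]
  · have hc : (emb x).1 i = Sum.inl (x.t i) := by rw [emb_apply, if_neg hi]
    simp only [stepC, localStep, hc, arrivesAs_emb]
    by_cases hb : x.q.1.2 = 1
    · rcases hmv with h | h
      · by_cases hi' : i = x.p + 1
        · simp [hb, h, hi']
        · have : i - 1 ≠ x.p := fun h' => hi' (by rw [← h']; ring)
          simp [hb, h, hi', this]
      · by_cases hi' : i = x.p - 1
        · simp [hb, h, hi', sub_eq_add_neg]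
        · have h1 : i + 1 ≠ x.p := fun h' => hi' (by rw [← h']; ring)
          have h3 : i ≠ x.p + -1 := by rwa [← sub_eq_add_neg]
          simp [hb, h, h3, h1]
    · simp [hb, hi]

theorem stepC_of_notMem {ℓ : ℕ} {w : CConf DQ Letter ℓ} (h : w ∉ Set.range emb) :
    stepC decStep ℓ w.1 = w.1 := by
  funext i
  obtain ⟨a, ha⟩ := eq_inl_of_notMem_range h i
  obtain ⟨b, hb⟩ := eq_inl_of_notMem_range h (i - 1)
  obtain ⟨c, hc⟩ := eq_inl_of_notMem_range h (i + 1)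
  simp [stepC, ha, hb, hc, localStep, arrivesAs]

theorem liftHom_eq_iterate {ℓ : ℕ} (h2 : 2 ≤ ℓ) (n : ℕ) (σ : Equiv.Perm (HC ℓ))
    (hσ : ⇑σ = tmF^[n]) (w : CConf DQ Letter ℓ) :
    (liftHom σ w).1 = (stepC decStep ℓ)^[n] w.1 := by
  by_cases hw : w ∈ Set.range emb
  · obtain ⟨x, rfl⟩ := hw
    have h : Function.Semiconj (fun x : HC ℓ => (emb x).1) tmF (stepC decStep ℓ) :=
      fun x => (stepC_emb h2 x).symm
    rw [liftHom_emb, hσ]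
    exact (h.iterate_right n) x
  · rw [liftHom_of_notMem σ hw, Function.iterate_fixed (stepC_of_notMem hw)]

theorem list_prod_mem_closure {G : Type*} [Group G] {F : Set G} {w : List G}
    (h : ∀ x ∈ w, x ∈ F ∨ x⁻¹ ∈ F) : w.prod ∈ Subgroup.closure F :=
  Subgroup.list_prod_mem _ fun x hx => (h x hx).elim (fun h => Subgroup.subset_closure h)
    fun h => (Subgroup.inv_mem_iff _).1 (Subgroup.subset_closure h)

theorem wordNorm_prod_le {G : Type*} [Group G] {F : Set G} {w : List G}
    (h : ∀ x ∈ w, x ∈ F ∨ x⁻¹ ∈ F) : wordNorm F w.prod ≤ w.length :=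
  Nat.sInf_le ⟨w, rfl, h, rfl⟩

/-- **Lemma.** There is a constant `K > 0` such that for every `ℓ ≥ 2` and every `n`, the
`n`-th power of the action `T_ℓ` of the decorated SMART machine on cyclic tapes of length
`ℓ` belongs to the group `G_ℓ` of Turing machine instructions with word norm at most
`K·ℓ⁴`. -/
theorem decorated_smart_cyclic_distortion :
    ∃ K : ℝ, 0 < K ∧ ∀ ℓ : ℕ, 2 ≤ ℓ → ∀ n : ℕ,
      ∃ π : Equiv.Perm (CConf DQ Letter ℓ),
        π ∈ Subgroup.closure (TMGens DQ Letter ℓ) ∧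
        (∀ w : CConf DQ Letter ℓ, (π w).1 = (stepC decStep ℓ)^[n] w.1) ∧
        (wordNorm (TMGens DQ Letter ℓ) π : ℝ) ≤ K * (ℓ : ℝ) ^ 4 := by
  obtain ⟨C, hC⟩ := exists_FC_tmF
  refine ⟨C + 1, by positivity, fun ℓ h2 n => ?_⟩
  obtain ⟨w, hlen, hgen, hprod⟩ := hC ℓ h2 n
  have hgen' : ∀ x ∈ w.map liftHom, x ∈ TMGens DQ Letter ℓ ∨ x⁻¹ ∈ TMGens DQ Letter ℓ := by
    intro x hx
    obtain ⟨σ, hσ, rfl⟩ := List.mem_map.1 hx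
    rw [← map_inv]
    exact (hgen σ hσ).imp IsGen.liftHom_mem IsGen.liftHom_mem
  refine ⟨(w.map liftHom).prod, list_prod_mem_closure hgen', fun v => ?_, ?_⟩
  · rw [← map_list_prod]
    exact liftHom_eq_iterate h2 n _ hprod v
  · have h : wordNorm (TMGens DQ Letter ℓ) (w.map liftHom).prod ≤ C * ℓ ^ 4 :=
      (wordNorm_prod_le hgen').trans (by rwa [List.length_map])
    have h' : (wordNorm (TMGens DQ Letter ℓ) (w.map liftHom).prod : ℝ) ≤ C * (ℓ : ℝ) ^ 4 := by
      exact_mod_cast h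
    have : (0 : ℝ) ≤ (ℓ : ℝ) ^ 4 := by positivity
    linarith
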